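/- arXiv:2109.08579 — 3 statements merged into one kernel-verified Lean document; each statement's English description precedes it below -/
import Mathlib

section
/- Let m, T be natural numbers and let a_{k,ℓ} (0 ≤ k ≤ m, 0 ≤ ℓ ≤ T) be real numbers, defining the operator S f(y) = ∑_{k=0}^m ∑_{ℓ=0}^T a_{k,ℓ} y^k f^{(ℓ)}(y). Let Y be a real-valued random variable with E[|Y|^m] < ∞ such that for every t ∈ ℝ, E[S g(Y)] = 0 both for g(y) = cos(ty) and for g(y) = sin(ty). Then the characteristic function φ_Y(t) = E[e^{itY}] satisfies the ordinary differential equation ∑_{k=0}^m ∑_{ℓ=0}^T a_{k,ℓ} 𝗂^{ℓ−k} t^ℓ φ_Y^{(k)}(t) = 0 for all t ∈ ℝ, where 𝗂 is the imaginary unit and φ_Y^{(k)} denotes the k-th derivative of φ_Y. -/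
open MeasureTheory ProbabilityTheory Filter Set
open scoped Topology

lemma aux_cos_sin (l : ℕ) (x : ℝ) :
    ((iteratedDeriv l Real.cos x : ℝ) : ℂ) + Complex.I * ((iteratedDeriv l Real.sin x : ℝ) : ℂ)
      = Complex.I ^ l * Complex.exp (Complex.I * x) := by
  induction l with
  | zero =>
    rw [mul_comm Complex.I (x : ℂ), Complex.exp_mul_I]
    simp [mul_comm]
  | succ l ih =>
    have h1 : iteratedDeriv (l + 1) Real.cos x = - iteratedDeriv l Real.sin x := by
      rw [iteratedDeriv_succ', Real.deriv_cos', iteratedDeriv_fun_neg]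
    have h2 : iteratedDeriv (l + 1) Real.sin x = iteratedDeriv l Real.cos x := by
      rw [iteratedDeriv_succ', Real.deriv_sin]
    rw [h1, h2, pow_succ', mul_assoc, ← ih]
    push_cast
    linear_combination (-((iteratedDeriv l Real.sin x : ℝ) : ℂ)) * Complex.I_mul_I

lemma aux_cos_sin_mul (l : ℕ) (t x : ℝ) :
    ((iteratedDeriv l (fun y : ℝ => Real.cos (t * y)) x : ℝ) : ℂ)
      + Complex.I * ((iteratedDeriv l (fun y : ℝ => Real.sin (t * y)) x : ℝ) : ℂ)
      = Complex.I ^ l * (t : ℂ) ^ l * Complex.exp (t * x * Complex.I) := by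
  rw [iteratedDeriv_comp_const_mul Real.contDiff_cos, iteratedDeriv_comp_const_mul Real.contDiff_sin]
  have h := aux_cos_sin l (t * x)
  push_cast at h ⊢
  rw [mul_comm (t * x : ℂ) Complex.I]
  linear_combination (t : ℂ) ^ l * h

/-- If `Y` has finite `m`-th absolute moment and the Stein operator
`S f y = ∑ k ≤ m, ∑ ℓ ≤ T, a k ℓ * y^k * f^(ℓ)(y)` satisfies `E[S g(Y)] = 0` for
`g(y) = cos (t y)` and `g(y) = sin (t y)` for every `t`, then the characteristic
function of `Y` satisfies the ODE
`∑ k, ∑ ℓ, a k ℓ * i^(ℓ-k) * t^ℓ * φ^(k)(t) = 0`. -/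
theorem stein_operator_gives_charFun_ODE
    {Ω : Type*} [MeasurableSpace Ω] (μ : Measure Ω) [IsProbabilityMeasure μ]
    (m T : ℕ) (a : ℕ → ℕ → ℝ)
    (Y : Ω → ℝ) (hY : Measurable Y)
    (hmom : Integrable (fun ω => |Y ω| ^ m) μ)
    (hcos : ∀ t : ℝ,
      ∫ ω, (∑ k ∈ Finset.range (m + 1), ∑ l ∈ Finset.range (T + 1),
        a k l * (Y ω) ^ k * iteratedDeriv l (fun y : ℝ => Real.cos (t * y)) (Y ω)) ∂μ = 0)
    (hsin : ∀ t : ℝ,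
      ∫ ω, (∑ k ∈ Finset.range (m + 1), ∑ l ∈ Finset.range (T + 1),
        a k l * (Y ω) ^ k * iteratedDeriv l (fun y : ℝ => Real.sin (t * y)) (Y ω)) ∂μ = 0) :
    ∀ t : ℝ,
      ∑ k ∈ Finset.range (m + 1), ∑ l ∈ Finset.range (T + 1),
        (a k l : ℂ) * Complex.I ^ ((l : ℤ) - (k : ℤ)) * (t : ℂ) ^ l *
          iteratedDeriv k
            (fun s : ℝ => ∫ ω, Complex.exp (Complex.I * (s : ℂ) * (Y ω : ℂ)) ∂μ) t = 0 := by
  intro t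
  have hmem : MemLp Y m μ := by
    rcases Nat.eq_zero_or_pos m with rfl | hm
    · simpa using hY.aestronglyMeasurable
    · rw [← integrable_norm_rpow_iff hY.aestronglyMeasurable (by exact_mod_cast hm.ne') (by simp)]
      simpa using hmom
  have hmemk : ∀ k ≤ m, MemLp Y k μ := fun k hk => hmem.mono_exponent (by exact_mod_cast hk)
  have hint : ∀ k ≤ m, Integrable
      (fun ω => (Y ω : ℂ) ^ k * Complex.exp (t * Y ω * Complex.I)) μ := by
    intro k hk
    refine Integrable.mono' (hmemk k hk).integrable_norm_pow' (by fun_prop) ?_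
    refine Eventually.of_forall fun ω => ?_
    rw [norm_mul, ← Complex.ofReal_mul, Complex.norm_exp_ofReal_mul_I]
    simp
  have hder : ∀ k ≤ m, iteratedDeriv k
      (fun s : ℝ => ∫ ω, Complex.exp (Complex.I * (s : ℂ) * (Y ω : ℂ)) ∂μ) t
      = Complex.I ^ k * ∫ ω, (Y ω : ℂ) ^ k * Complex.exp (t * Y ω * Complex.I) ∂μ := by
    intro k hk
    have : IsProbabilityMeasure (μ.map Y) := Measure.isProbabilityMeasure_map hY.aemeasurable
    have h1 : (fun s : ℝ => ∫ ω, Complex.exp (Complex.I * (s : ℂ) * (Y ω : ℂ)) ∂μ)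
        = charFun (μ.map Y) := by
      funext s
      rw [charFun_apply_real, integral_map hY.aemeasurable (by fun_prop)]
      congr 1; funext ω; congr 1; ring
    rw [h1, iteratedDeriv_charFun, integral_map hY.aemeasurable (by fun_prop)]
    rw [memLp_map_measure_iff (by fun_prop) hY.aemeasurable]
    exact hmemk k hk
  set G : Ω → ℂ := fun ω => ∑ k ∈ Finset.range (m + 1), ∑ l ∈ Finset.range (T + 1),
    ((a k l : ℂ) * Complex.I ^ l * (t : ℂ) ^ l) *
      ((Y ω : ℂ) ^ k * Complex.exp (t * Y ω * Complex.I)) with hG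
  have hterm : ∀ k ∈ Finset.range (m + 1), ∀ l ∈ Finset.range (T + 1), Integrable (fun ω =>
      ((a k l : ℂ) * Complex.I ^ l * (t : ℂ) ^ l) *
      ((Y ω : ℂ) ^ k * Complex.exp (t * Y ω * Complex.I))) μ := fun k hk l _ =>
    (hint k (by simpa [Nat.lt_succ_iff] using hk)).const_mul _
  have hGint : Integrable G μ :=
    integrable_finsetSum _ fun k hk => integrable_finsetSum _ fun l hl => hterm k hk l hl
  have hGeq : ∀ ω, G ω =
      ((∑ k ∈ Finset.range (m + 1), ∑ l ∈ Finset.range (T + 1),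
        a k l * (Y ω) ^ k * iteratedDeriv l (fun y : ℝ => Real.cos (t * y)) (Y ω) : ℝ) : ℂ)
      + Complex.I * ((∑ k ∈ Finset.range (m + 1), ∑ l ∈ Finset.range (T + 1),
        a k l * (Y ω) ^ k * iteratedDeriv l (fun y : ℝ => Real.sin (t * y)) (Y ω) : ℝ) : ℂ) := by
    intro ω
    simp only [hG, Complex.ofReal_sum, Finset.mul_sum, ← Finset.sum_add_distrib]
    refine Finset.sum_congr rfl fun k _ => Finset.sum_congr rfl fun l _ => ?_
    have h := aux_cos_sin_mul l t (Y ω)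
    rw [Complex.ofReal_mul, Complex.ofReal_mul, Complex.ofReal_mul, Complex.ofReal_mul,
      Complex.ofReal_pow]
    linear_combination (-(a k l : ℂ) * (Y ω : ℂ) ^ k) * h
  have hG0 : ∫ ω, G ω ∂μ = 0 := by
    apply Complex.ext
    · have h := integral_re hGint
      simp only [RCLike.re_eq_complex_re] at h
      rw [← h, Complex.zero_re, ← hcos t]
      congr 1; funext ω; rw [hGeq, Complex.add_re, Complex.I_mul_re, Complex.ofReal_re, Complex.ofReal_im]; simp
    · have h := integral_im hGint
      simp only [RCLike.im_eq_complex_im] at h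
      rw [← h, Complex.zero_im, ← hsin t]
      congr 1; funext ω; rw [hGeq, Complex.add_im, Complex.I_mul_im, Complex.ofReal_re, Complex.ofReal_im]; simp
  rw [← hG0, hG, integral_finsetSum _ fun k hk => integrable_finsetSum _ fun l hl => hterm k hk l hl]
  refine Finset.sum_congr rfl fun k hk => ?_
  rw [integral_finsetSum _ fun l hl => hterm k hk l hl]
  refine Finset.sum_congr rfl fun l hl => ?_
  rw [integral_const_mul, hder k (by simpa [Nat.lt_succ_iff] using hk),
    zpow_sub₀ Complex.I_ne_zero, zpow_natCast, zpow_natCast]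
  have := pow_ne_zero k Complex.I_ne_zero
  generalize (∫ ω, (Y ω : ℂ) ^ k * Complex.exp (t * Y ω * Complex.I) ∂μ) = J
  field_simp
end

section
/- Let T be a natural number and a_{0,ℓ}, a_{1,ℓ}, a_{2,ℓ} (0 ≤ ℓ ≤ T) be real numbers, defining the operator S f(y) = ∑_{ℓ=0}^T (a_{0,ℓ} + a_{1,ℓ} y + a_{2,ℓ} y²) f^{(ℓ)}(y). Let Y be a continuous real-valued random variable with E[Y²] < ∞ such that E[S f(Y)] = 0 for all f ∈ F_{S,Y}. Define the rational function p(t) = (∑_{ℓ=0}^T a_{1,ℓ} 𝗂^{ℓ−1} t^ℓ) / (∑_{ℓ=0}^T a_{2,ℓ} 𝗂^{ℓ−2} t^ℓ). Suppose there exist a ∈ ℝ \ {0} and b ≥ −2 such that p(t) ∼ a𝗂/t² + b/t as t → 0, i.e. lim_{t→0} t² p(t) = a𝗂 and lim_{t→0} t (p(t) − a𝗂/t²) = b. Then the following holds: if W is a real-valued random variable with E[W²] < ∞ such that E[S f(W)] = 0 for all f ∈ F_{S,Y}, then W is equal in law to Y. -/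
open MeasureTheory ProbabilityTheory Filter Set
open scoped Topology

/-- The Stein operator with quadratic coefficients:
`S f y = ∑ ℓ ≤ T, (a₀ ℓ + a₁ ℓ * y + a₂ ℓ * y²) * f^(ℓ)(y)`. -/
noncomputable def steinQuad (T : ℕ) (a₀ a₁ a₂ : ℕ → ℝ) (f : ℝ → ℝ) (y : ℝ) : ℝ :=
  ∑ l ∈ Finset.range (T + 1), (a₀ l + a₁ l * y + a₂ l * y ^ 2) * iteratedDeriv l f y

/-- Membership in the class `F_{S,Y}` (maximal coefficient degree `m = 2`). -/
def memFquad {Ω : Type*} [MeasurableSpace Ω] (μ : Measure Ω) (Y : Ω → ℝ) (T : ℕ)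
    (f : ℝ → ℝ) : Prop :=
  ContDiff ℝ (T : ℕ∞) f ∧
    ∀ t ≤ T, ∀ j ≤ 2, Integrable (fun ω => (Y ω) ^ j * iteratedDeriv t f (Y ω)) μ

/-- The rational function `p(t) = (∑ ℓ a₁ ℓ i^(ℓ-1) t^ℓ) / (∑ ℓ a₂ ℓ i^(ℓ-2) t^ℓ)`. -/
noncomputable def pFun (T : ℕ) (a₁ a₂ : ℕ → ℝ) (t : ℝ) : ℂ :=
  (∑ l ∈ Finset.range (T + 1), (a₁ l : ℂ) * Complex.I ^ ((l : ℤ) - 1) * (t : ℂ) ^ l) /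
    (∑ l ∈ Finset.range (T + 1), (a₂ l : ℂ) * Complex.I ^ ((l : ℤ) - 2) * (t : ℂ) ^ l)


/-- limit of a polynomial divided by its lowest order -/
lemma poly_low (T : ℕ) (c : ℕ → ℂ) (d : ℕ) (hd : d ≤ T) (h0 : ∀ l < d, c l = 0) :
    Tendsto (fun t : ℝ => (∑ l ∈ Finset.range (T + 1), c l * (t : ℂ) ^ l) / (t : ℂ) ^ d)
      (𝓝[≠] (0 : ℝ)) (𝓝 (c d)) := by
  have h1 : Tendsto (fun t : ℝ => ∑ l ∈ Finset.range (T + 1), c l * (t : ℂ) ^ (l - d))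
      (𝓝[≠] (0 : ℝ)) (𝓝 (c d)) := by
    have hc : Continuous (fun t : ℝ => ∑ l ∈ Finset.range (T + 1), c l * (t : ℂ) ^ (l - d)) := by
      fun_prop
    have := (hc.tendsto 0).mono_left (nhdsWithin_le_nhds (s := {0}ᶜ))
    convert this using 2
    rw [Finset.sum_eq_single d]
    · simp
    · intro l _ hl
      rcases lt_or_gt_of_ne hl with h | h
      · simp [h0 l h]
      · simp [Nat.sub_ne_zero_of_lt h]
    · intro h; exact absurd (Finset.mem_range.2 (by omega)) h
  refine h1.congr' ?_
  filter_upwards [self_mem_nhdsWithin] with t ht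
  have ht' : (t : ℂ) ≠ 0 := by exact_mod_cast ht
  rw [Finset.sum_div]
  refine Finset.sum_congr rfl fun l _ => ?_
  rcases lt_or_ge l d with h | h
  · simp [h0 l h]
  · rw [mul_div_assoc]; congr 1
    rw [eq_div_iff (pow_ne_zero _ ht'), ← pow_add, Nat.sub_add_cancel h]

lemma coeffs (T : ℕ) (a₁ a₂ : ℕ → ℝ) (a : ℝ) (ha : a ≠ 0)
    (hlim1 : Tendsto (fun t : ℝ => (t : ℂ) ^ 2 * pFun T a₁ a₂ t)
      (𝓝[≠] (0 : ℝ)) (𝓝 ((a : ℂ) * Complex.I))) :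
    ∃ k, k + 2 ≤ T ∧ (∀ l < k + 2, a₂ l = 0) ∧ a₂ (k + 2) ≠ 0 ∧ (∀ l < k, a₁ l = 0) ∧
      a₁ k ≠ 0 := by
  have haI : (a : ℂ) * Complex.I ≠ 0 := by simp [ha]
  have key : ∀ c : ℕ → ℝ, (∃ l ≤ T, c l ≠ 0) → ∃ d ≤ T, c d ≠ 0 ∧ ∀ l < d, c l = 0 := by
    intro c hc
    classical
    refine ⟨Nat.find hc, (Nat.find_spec hc).1, (Nat.find_spec hc).2, fun l hl => ?_⟩
    by_contra h
    exact Nat.find_min hc hl ⟨(hl.le.trans (Nat.find_spec hc).1), h⟩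
  have hc0 : Tendsto (fun t : ℝ => (t : ℂ)) (𝓝[≠] (0 : ℝ)) (𝓝 0) := by
    have : Continuous (fun t : ℝ => (t : ℂ)) := by fun_prop
    simpa using (this.tendsto 0).mono_left (nhdsWithin_le_nhds (s := {0}ᶜ))
  have contra0 : (∀ t, pFun T a₁ a₂ t = 0) → False := by
    intro h
    simp only [h, mul_zero] at hlim1
    exact haI (tendsto_nhds_unique hlim1 tendsto_const_nhds)
  obtain ⟨d, hdT, hd, hd0⟩ : ∃ d ≤ T, a₂ d ≠ 0 ∧ ∀ l < d, a₂ l = 0 := by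
    apply key
    by_contra h
    push Not at h
    apply contra0
    intro t
    unfold pFun
    rw [Finset.sum_eq_zero (s := Finset.range (T + 1))
      (f := fun l => (a₂ l : ℂ) * Complex.I ^ ((l : ℤ) - 2) * (t : ℂ) ^ l), div_zero]
    intro l hl
    simp [h l (by simpa [Nat.lt_succ_iff] using hl)]
  obtain ⟨e, heT, he, he0⟩ : ∃ d ≤ T, a₁ d ≠ 0 ∧ ∀ l < d, a₁ l = 0 := by
    apply key
    by_contra h
    push Not at h
    apply contra0
    intro t
    unfold pFun
    rw [Finset.sum_eq_zero (s := Finset.range (T + 1))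
      (f := fun l => (a₁ l : ℂ) * Complex.I ^ ((l : ℤ) - 1) * (t : ℂ) ^ l), zero_div]
    intro l hl
    simp [h l (by simpa [Nat.lt_succ_iff] using hl)]
  have hD := poly_low T (fun l => (a₂ l : ℂ) * Complex.I ^ ((l : ℤ) - 2)) d hdT
    (fun l hl => by simp [hd0 l hl])
  have hN := poly_low T (fun l => (a₁ l : ℂ) * Complex.I ^ ((l : ℤ) - 1)) e heT
    (fun l hl => by simp [he0 l hl])
  set D : ℝ → ℂ := fun t => ∑ l ∈ Finset.range (T + 1), (a₂ l : ℂ) * Complex.I ^ ((l : ℤ) - 2) * (t : ℂ) ^ l with hDdef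
  set N : ℝ → ℂ := fun t => ∑ l ∈ Finset.range (T + 1), (a₁ l : ℂ) * Complex.I ^ ((l : ℤ) - 1) * (t : ℂ) ^ l with hNdef
  have hdne : (a₂ d : ℂ) * Complex.I ^ ((d : ℤ) - 2) ≠ 0 :=
    mul_ne_zero (by exact_mod_cast hd) (zpow_ne_zero _ Complex.I_ne_zero)
  have hene : (a₁ e : ℂ) * Complex.I ^ ((e : ℤ) - 1) ≠ 0 :=
    mul_ne_zero (by exact_mod_cast he) (zpow_ne_zero _ Complex.I_ne_zero)
  have hL : Tendsto (fun t : ℝ => (t : ℂ) ^ 2 * N t / (t : ℂ) ^ d) (𝓝[≠] (0 : ℝ))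
      (𝓝 ((a : ℂ) * Complex.I * ((a₂ d : ℂ) * Complex.I ^ ((d : ℤ) - 2)))) := by
    refine (hlim1.mul hD).congr' ?_
    filter_upwards [self_mem_nhdsWithin, hD.eventually_ne hdne] with t ht hDt
    have hDt' : D t ≠ 0 := by
      intro h
      apply hDt
      change D t / _ = 0
      rw [h, zero_div]
    change (t : ℂ) ^ 2 * (N t / D t) * (D t / (t : ℂ) ^ d) = _
    field_simp
  have hLne := mul_ne_zero haI hdne
  have hed : e + 2 = d := by
    rcases lt_trichotomy (e + 2) d with h | h | h
    · exfalso
      have h1 : Tendsto (fun t : ℝ => (t : ℂ) ^ (d - (e + 2)) * ((t : ℂ) ^ 2 * N t / (t : ℂ) ^ d))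
          (𝓝[≠] (0 : ℝ)) (𝓝 0) := by
        have := (hc0.pow (d - (e + 2))).mul hL
        rwa [zero_pow (by omega), zero_mul] at this
      refine hene (tendsto_nhds_unique hN (h1.congr' ?_))
      filter_upwards [self_mem_nhdsWithin] with t ht
      have ht' : (t : ℂ) ≠ 0 := by exact_mod_cast ht
      change _ = N t / (t : ℂ) ^ e
      obtain ⟨m, rfl⟩ := Nat.exists_eq_add_of_lt h
      rw [show e + 2 + m + 1 - (e + 2) = m + 1 by omega]
      field_simp
      ring
    · exact h
    · exfalso
      have h1 : Tendsto (fun t : ℝ => (t : ℂ) ^ (e + 2 - d) * (N t / (t : ℂ) ^ e))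
          (𝓝[≠] (0 : ℝ)) (𝓝 0) := by
        have := (hc0.pow (e + 2 - d)).mul hN
        rwa [zero_pow (by omega), zero_mul] at this
      refine hLne (tendsto_nhds_unique hL (h1.congr' ?_))
      filter_upwards [self_mem_nhdsWithin] with t ht
      have ht' : (t : ℂ) ≠ 0 := by exact_mod_cast ht
      rw [mul_div_assoc', div_eq_div_iff (pow_ne_zero _ ht') (pow_ne_zero _ ht')]
      have : (t : ℂ) ^ (e + 2 - d) * (t : ℂ) ^ d = (t : ℂ) ^ 2 * (t : ℂ) ^ e := by
        rw [← pow_add, ← pow_add]; congr 1; omega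
      linear_combination N t * this
  subst hed
  exact ⟨e, hdT, hd0, hd, he0, he⟩

/-- smooth functions with all derivatives bounded -/
def BB (f : ℝ → ℝ) : Prop :=
  ContDiff ℝ (⊤ : ℕ∞) f ∧ ∀ l, ∃ C, ∀ y, |iteratedDeriv l f y| ≤ C

lemma BB.deriv {f : ℝ → ℝ} (h : BB f) : BB (deriv f) := by
  refine ⟨?_, fun l => ?_⟩
  · exact (contDiff_infty_iff_deriv.1 h.1).2
  · rw [← iteratedDeriv_succ']; exact h.2 (l + 1)

lemma BB.iter {f : ℝ → ℝ} (h : BB f) (j : ℕ) : BB (iteratedDeriv j f) := by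
  induction j with
  | zero => simpa using h
  | succ n ih => rw [iteratedDeriv_succ]; exact ih.deriv

lemma BB.cont {f : ℝ → ℝ} (h : BB f) (j : ℕ) : Continuous (iteratedDeriv j f) :=
  (h.iter j).1.continuous

/-- the operator applied to a jet -/
noncomputable def Sq (T : ℕ) (a₀ a₁ a₂ : ℕ → ℝ) (d : ℕ → ℝ) (y : ℝ) : ℝ :=
  ∑ l ∈ Finset.range (T + 1), (a₀ l + a₁ l * y + a₂ l * y ^ 2) * d l

noncomputable def Asum (T : ℕ) (a₀ a₁ a₂ : ℕ → ℝ) : ℝ :=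
  ∑ l ∈ Finset.range (T + 1), (|a₀ l| + |a₁ l| + |a₂ l|)

lemma Asum_nonneg (T : ℕ) (a₀ a₁ a₂ : ℕ → ℝ) : 0 ≤ Asum T a₀ a₁ a₂ :=
  Finset.sum_nonneg fun _ _ => by positivity

lemma coef_bound (u v w y : ℝ) : |u + v * y + w * y ^ 2| ≤ (|u| + |v| + |w|) * (1 + y ^ 2) := by
  have h1 : |y| ≤ 1 + y ^ 2 := by
    rw [abs_le]; constructor <;> nlinarith [sq_nonneg (y - 1), sq_nonneg (y + 1)]
  calc |u + v * y + w * y ^ 2| ≤ |u| + |v * y| + |w * y ^ 2| := abs_add_three _ _ _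
    _ = |u| + |v| * |y| + |w| * y ^ 2 := by
        rw [abs_mul, abs_mul, abs_of_nonneg (sq_nonneg y)]
    _ ≤ _ := by nlinarith [abs_nonneg u, abs_nonneg v, abs_nonneg w, sq_nonneg y,
        mul_le_mul_of_nonneg_left h1 (abs_nonneg v), mul_nonneg (abs_nonneg u) (sq_nonneg y)]

lemma Sq_bound (T : ℕ) (a₀ a₁ a₂ : ℕ → ℝ) (d : ℕ → ℝ) (y C : ℝ) (hC : ∀ l ≤ T, |d l| ≤ C) :
    |Sq T a₀ a₁ a₂ d y| ≤ Asum T a₀ a₁ a₂ * C * (1 + y ^ 2) := by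
  unfold Sq Asum
  refine (Finset.abs_sum_le_sum_abs _ _).trans ?_
  rw [Finset.sum_mul, Finset.sum_mul]
  refine Finset.sum_le_sum fun l hl => ?_
  rw [abs_mul]
  have h1 := coef_bound (a₀ l) (a₁ l) (a₂ l) y
  have h2 := hC l (by simpa [Nat.lt_succ_iff] using hl)
  calc _ ≤ ((|a₀ l| + |a₁ l| + |a₂ l|) * (1 + y ^ 2)) * C := by
        apply mul_le_mul h1 h2 (abs_nonneg _) (by positivity)
    _ = _ := by ring

section
variable {Ω : Type*} [MeasurableSpace Ω] (μ : Measure Ω) [IsProbabilityMeasure μ]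
  (Y : Ω → ℝ) (hY : Measurable Y) (hYmom : Integrable (fun ω => (Y ω) ^ 2) μ)

lemma BB_uniform {f : ℝ → ℝ} (h : BB f) (T : ℕ) : ∃ C, ∀ l ≤ T, ∀ y, |iteratedDeriv l f y| ≤ C := by
  choose C hC using h.2
  refine ⟨∑ l ∈ Finset.range (T + 1), C l, fun l hl y => (hC l y).trans ?_⟩
  exact Finset.single_le_sum (f := C) (fun i _ => (abs_nonneg _).trans (hC i 0))
    (Finset.mem_range.2 (by omega))

include hY hYmom in
lemma BB_mem {f : ℝ → ℝ} (h : BB f) (T : ℕ) : memFquad μ Y T f := by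
  refine ⟨h.1.of_le (by exact_mod_cast le_top), fun t ht j hj => ?_⟩
  obtain ⟨C, hC⟩ := h.2 t
  have hC0 : 0 ≤ C := (abs_nonneg _).trans (hC 0)
  refine Integrable.mono' (((integrable_const (1 : ℝ)).add hYmom).const_mul C) ?_ ?_
  · exact ((hY.pow_const j).mul ((h.cont t).measurable.comp hY)).aestronglyMeasurable
  · refine Eventually.of_forall fun ω => ?_
    have h1 : |Y ω ^ j| ≤ 1 + Y ω ^ 2 := by
      interval_cases j
      · simp; positivity
      · rw [pow_one, abs_le]; constructor <;> nlinarith [sq_nonneg (Y ω - 1), sq_nonneg (Y ω + 1)]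
      · rw [abs_of_nonneg (sq_nonneg _)]; linarith
    simp only [Real.norm_eq_abs, abs_mul, Pi.add_apply]
    rw [mul_comm]
    exact mul_le_mul (hC _) h1 (abs_nonneg _) hC0

include hYmom in
lemma dct_Sq (T : ℕ) (a₀ a₁ a₂ : ℕ → ℝ) (d : ℕ → ℕ → ℝ → ℝ) (g : ℕ → ℝ → ℝ)
    (hY : Measurable Y)
    (hm : ∀ n l, Measurable (d n l)) (C : ℝ) (hC : ∀ n, ∀ l ≤ T, ∀ y, |d n l y| ≤ C)
    (hlim : ∀ l ≤ T, ∀ y, Tendsto (fun n => d n l y) atTop (𝓝 (g l y)))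
    (h0 : ∀ n, ∫ ω, Sq T a₀ a₁ a₂ (fun l => d n l (Y ω)) (Y ω) ∂μ = 0) :
    ∫ ω, Sq T a₀ a₁ a₂ (fun l => g l (Y ω)) (Y ω) ∂μ = 0 := by
  have h := tendsto_integral_of_dominated_convergence (μ := μ)
    (F := fun n ω => Sq T a₀ a₁ a₂ (fun l => d n l (Y ω)) (Y ω))
    (f := fun ω => Sq T a₀ a₁ a₂ (fun l => g l (Y ω)) (Y ω))
    (fun ω => Asum T a₀ a₁ a₂ * C * (1 + Y ω ^ 2))
    (fun n => by
      unfold Sq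
      refine Measurable.aestronglyMeasurable ?_
      refine Finset.measurable_sum _ fun l _ => ?_
      exact Measurable.mul (by fun_prop) ((hm n l).comp hY))
    (((integrable_const (1 : ℝ)).add hYmom).const_mul _)
    (fun n => Eventually.of_forall fun ω => by
      rw [Real.norm_eq_abs]
      exact Sq_bound _ _ _ _ _ _ _ fun l hl => hC n l hl _)
    (Eventually.of_forall fun ω => by
      unfold Sq
      refine tendsto_finsetSum _ fun l hl => ?_
      exact (hlim l (by simpa [Nat.lt_succ_iff] using hl) (Y ω)).const_mul _)
  simp only [h0] at h
  exact tendsto_nhds_unique h tendsto_const_nhds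
end

lemma stein_eq_Sq (T : ℕ) (a₀ a₁ a₂ : ℕ → ℝ) (f : ℝ → ℝ) (y : ℝ) :
    steinQuad T a₀ a₁ a₂ f y = Sq T a₀ a₁ a₂ (fun l => iteratedDeriv l f y) y := rfl

lemma iter_sin (ε w : ℝ) (l : ℕ) : iteratedDeriv l (fun y => Real.sin (ε * y + w)) =
    fun y => ε ^ l * Real.sin (ε * y + w + l * (Real.pi / 2)) := by
  induction l with
  | zero => simp
  | succ n ih =>
    rw [iteratedDeriv_succ, ih]
    ext y
    have h : HasDerivAt (fun y => ε ^ n * Real.sin (ε * y + w + n * (Real.pi / 2)))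
        (ε ^ n * (Real.cos (ε * y + w + n * (Real.pi / 2)) * (ε * 1))) y := by
      refine HasDerivAt.const_mul _ (HasDerivAt.sin ?_)
      exact (((hasDerivAt_id y).const_mul ε).add_const _).add_const _
    rw [h.deriv]
    push_cast
    rw [show ε * y + w + (n + 1) * (Real.pi / 2) = ε * y + w + n * (Real.pi / 2) + Real.pi / 2 by ring,
      Real.sin_add_pi_div_two]
    ring

lemma BB_sin (ε w : ℝ) : BB (fun y => Real.sin (ε * y + w)) := by
  refine ⟨by fun_prop, fun l => ⟨|ε ^ l|, fun y => ?_⟩⟩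
  rw [iter_sin, abs_mul]
  exact mul_le_of_le_one_right (abs_nonneg _) (Real.abs_sin_le_one _)

section
variable {Ω : Type*} [MeasurableSpace Ω] (μ : Measure Ω) [IsProbabilityMeasure μ]
  (Y : Ω → ℝ) (hY : Measurable Y) (hYmom : Integrable (fun ω => (Y ω) ^ 2) μ)

include hY hYmom in
lemma a0_zero (T : ℕ) (a₀ a₁ a₂ : ℕ → ℝ) (k : ℕ) (hk : k + 2 ≤ T) (h2 : ∀ l < k + 2, a₂ l = 0)
    (h1 : ∀ l < k, a₁ l = 0)
    (H : ∀ f, BB f → ∫ ω, steinQuad T a₀ a₁ a₂ f (Y ω) ∂μ = 0) : ∀ l < k, a₀ l = 0 := by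
  intro j
  induction j using Nat.strong_induction_on with
  | _ j ih =>
  intro hj
  have hz : ∀ l < j, a₀ l = 0 ∧ a₁ l = 0 ∧ a₂ l = 0 := fun l hl =>
    ⟨ih l hl (by omega), h1 l (by omega), h2 l (by omega)⟩
  set w : ℝ := Real.pi / 2 - j * (Real.pi / 2) with hw
  let ε : ℕ → ℝ := fun n => 1 / ((n : ℝ) + 1)
  have hε0 : ∀ n, 0 < ε n := fun n => by simp only [ε]; positivity
  have hε1 : ∀ n, ε n ≤ 1 := fun n => by
    simp only [ε]; rw [div_le_one (by positivity)]; linarith [(Nat.cast_nonneg n : (0:ℝ) ≤ n)]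
  have hεl : Tendsto ε atTop (𝓝 0) := tendsto_one_div_add_atTop_nhds_zero_nat
  have := dct_Sq μ Y hYmom T a₀ a₁ a₂
    (fun n l y => (ε n) ^ (l - j) * Real.sin (ε n * y + w + l * (Real.pi / 2)))
    (fun l y => 0 ^ (l - j) * Real.sin (0 * y + w + l * (Real.pi / 2)))
    hY (fun n l => by fun_prop) 1
    (fun n l _ y => by
      rw [abs_mul]
      refine mul_le_one₀ ?_ (abs_nonneg _) (Real.abs_sin_le_one _)
      rw [abs_of_pos (pow_pos (hε0 n) _)]
      exact pow_le_one₀ (hε0 n).le (hε1 n))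
    (fun l _ y => by
      have hc : Continuous (fun e : ℝ => e ^ (l - j) * Real.sin (e * y + w + l * (Real.pi / 2))) := by
        fun_prop
      exact (hc.tendsto 0).comp hεl)
    (fun n => by
      have h := H _ (BB_sin (ε n) w)
      simp only [stein_eq_Sq, iter_sin] at h
      have : ∀ y, Sq T a₀ a₁ a₂ (fun l => ε n ^ l * Real.sin (ε n * y + w + l * (Real.pi / 2))) y
          = ε n ^ j * Sq T a₀ a₁ a₂ (fun l => ε n ^ (l - j) *
            Real.sin (ε n * y + w + l * (Real.pi / 2))) y := by
        intro y
        unfold Sq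
        rw [Finset.mul_sum]
        refine Finset.sum_congr rfl fun l _ => ?_
        rcases lt_or_ge l j with hl | hl
        · obtain ⟨e0, e1, e2⟩ := hz l hl
          simp [e0, e1, e2]
        · beta_reduce
          rw [show ε n ^ l = ε n ^ j * ε n ^ (l - j) by rw [← pow_add]; congr 1; omega]
          ring
      simp only [this] at h
      rw [integral_const_mul] at h
      exact (mul_eq_zero.1 h).resolve_left (pow_ne_zero _ (hε0 n).ne'))
  have h3 : ∀ y, Sq T a₀ a₁ a₂ (fun l => 0 ^ (l - j) * Real.sin (0 * y + w + l * (Real.pi / 2))) y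
      = a₀ j := by
    intro y
    unfold Sq
    rw [Finset.sum_eq_single j]
    · rw [h1 j hj, h2 j (by omega)]
      simp [hw]
    · intro l _ hl
      rcases lt_or_gt_of_ne hl with h | h
      · obtain ⟨e0, e1, e2⟩ := hz l h
        simp [e0, e1, e2]
      · simp [Nat.sub_ne_zero_of_lt h]
    · intro h; exact absurd (Finset.mem_range.2 (by omega)) h
  simp only [h3] at this
  simpa using this
end

lemma BB_of_compact {f : ℝ → ℝ} (hf : ContDiff ℝ (⊤ : ℕ∞) f) (hc : HasCompactSupport f) : BB f := by
  have key : ∀ l, ContDiff ℝ (⊤ : ℕ∞) (iteratedDeriv l f) ∧ HasCompactSupport (iteratedDeriv l f) := by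
    intro l
    induction l with
    | zero => simpa using ⟨hf, hc⟩
    | succ n ih =>
      rw [iteratedDeriv_succ]
      exact ⟨(contDiff_infty_iff_deriv.1 ih.1).2, ih.2.deriv⟩
  refine ⟨hf, fun l => ?_⟩
  obtain ⟨C, hC⟩ := (key l).2.exists_bound_of_continuous (key l).1.continuous
  exact ⟨C, fun y => by simpa using hC y⟩

lemma exists_antideriv {h : ℝ → ℝ} (hf : ContDiff ℝ (⊤ : ℕ∞) h) (hc : HasCompactSupport h) :
    ∃ f, BB f ∧ deriv f = h := by
  have hB := BB_of_compact hf hc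
  have hd : deriv (fun u => ∫ x in (0:ℝ)..u, h x) = h :=
    funext fun b => Continuous.deriv_integral h hf.continuous 0 b
  refine ⟨fun u => ∫ x in (0:ℝ)..u, h x, ⟨?_, fun l => ?_⟩, hd⟩
  · rw [contDiff_infty_iff_deriv, hd]
    refine ⟨fun b => ?_, hf⟩
    exact (hf.continuous.integral_hasStrictDerivAt 0 b).hasDerivAt.differentiableAt
  · cases l with
    | zero =>
      refine ⟨∫ x, ‖h x‖, fun y => ?_⟩
      rw [iteratedDeriv_zero, ← Real.norm_eq_abs]
      refine intervalIntegral.norm_integral_le_integral_norm_uIoc.trans ?_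
      refine setIntegral_le_integral ?_ ?_
      · exact (hf.continuous.integrable_of_hasCompactSupport hc).norm
      · exact Eventually.of_forall fun x => norm_nonneg _
    | succ n =>
      rw [iteratedDeriv_succ', hd]
      exact hB.2 n

lemma exists_cut : ∃ χ : ℝ → ℝ, ContDiff ℝ (⊤ : ℕ∞) χ ∧ HasCompactSupport χ ∧ χ 0 = 1 := by
  let b : ContDiffBump (0 : ℝ) := ⟨1, 2, by norm_num, by norm_num⟩
  exact ⟨b, b.contDiff, b.hasCompactSupport,
    b.one_of_mem_closedBall (by simp [b])⟩

lemma ann_step {Ω : Type*} [MeasurableSpace Ω] (μ : Measure Ω) [IsProbabilityMeasure μ]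
    (Y : Ω → ℝ) (hY : Measurable Y) (hYmom : Integrable (fun ω => (Y ω) ^ 2) μ)
    (T : ℕ) (a₀ a₁ a₂ : ℕ → ℝ) (j : ℕ)
    (H : ∀ f, BB f → ∫ ω, Sq T a₀ a₁ a₂ (fun l => iteratedDeriv (l + (j + 1)) f (Y ω)) (Y ω) ∂μ = 0)
    (g : ℝ → ℝ) (hg : BB g) :
    ∫ ω, Sq T a₀ a₁ a₂ (fun l => iteratedDeriv (l + j) g (Y ω)) (Y ω) ∂μ = 0 := by
  obtain ⟨χ, hχ, hχc, hχ0⟩ := exists_cut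
  have hχB := BB_of_compact hχ hχc
  let ε : ℕ → ℝ := fun n => 1 / ((n : ℝ) + 1)
  have hε0 : ∀ n, 0 < ε n := fun n => by simp only [ε]; positivity
  have hε1 : ∀ n, ε n ≤ 1 := fun n => by
    simp only [ε]; rw [div_le_one (by positivity)]; linarith [(Nat.cast_nonneg n : (0:ℝ) ≤ n)]
  have hεl : Tendsto ε atTop (𝓝 0) := tendsto_one_div_add_atTop_nhds_zero_nat
  let h : ℕ → ℝ → ℝ := fun n => g * fun y => χ (ε n * y)
  have hχs : ∀ n, ContDiff ℝ (⊤ : ℕ∞) (fun y => χ (ε n * y)) := fun n => hχ.comp (by fun_prop)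
  have hhs : ∀ n, ContDiff ℝ (⊤ : ℕ∞) (h n) := fun n => hg.1.mul (hχs n)
  have hhc : ∀ n, HasCompactSupport (h n) := by
    intro n
    refine HasCompactSupport.mul_left ?_
    exact hχc.comp_homeomorph (Homeomorph.mulLeft₀ (ε n) (hε0 n).ne')
  have hform : ∀ n m y, iteratedDeriv m (h n) y = ∑ i ∈ Finset.range (m + 1),
      (m.choose i) * iteratedDeriv i g y * (ε n ^ (m - i) * iteratedDeriv (m - i) χ (ε n * y)) := by
    intro n m y
    rw [iteratedDeriv_mul (hg.1.of_le (by exact_mod_cast le_top)).contDiffAt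
      ((hχs n).of_le (by exact_mod_cast le_top)).contDiffAt]
    refine Finset.sum_congr rfl fun i _ => ?_
    rw [iteratedDeriv_comp_const_mul (contDiff_infty.1 hχ (m - i))]
  obtain ⟨C1, hC1⟩ := BB_uniform hg (T + j)
  obtain ⟨C2, hC2⟩ := BB_uniform hχB (T + j)
  have hC10 : 0 ≤ C1 := (abs_nonneg _).trans (hC1 0 (by omega) 0)
  have hC20 : 0 ≤ C2 := (abs_nonneg _).trans (hC2 0 (by omega) 0)
  refine dct_Sq μ Y hYmom T a₀ a₁ a₂ (fun n l y => iteratedDeriv (l + j) (h n) y)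
    (fun l y => iteratedDeriv (l + j) g y) hY
    (fun n l => ((BB_of_compact (hhs n) (hhc n)).cont _).measurable)
    (2 ^ (T + j) * (C1 * C2)) ?_ ?_ ?_
  · intro n l hl y
    rw [hform]
    refine (Finset.abs_sum_le_sum_abs _ _).trans ?_
    calc _ ≤ ∑ i ∈ Finset.range (l + j + 1), ((l + j).choose i : ℝ) * (C1 * C2) := by
          refine Finset.sum_le_sum fun i hi => ?_
          have hi' : i ≤ l + j := by simpa [Nat.lt_succ_iff] using hi
          rw [abs_mul, abs_mul, abs_mul, Nat.abs_cast, mul_assoc]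
          refine mul_le_mul_of_nonneg_left ?_ (Nat.cast_nonneg _)
          refine mul_le_mul (hC1 _ (by omega) _) ?_ (by positivity) hC10
          rw [abs_of_pos (pow_pos (hε0 n) _)]
          calc _ ≤ 1 * C2 := mul_le_mul (pow_le_one₀ (hε0 n).le (hε1 n)) (hC2 _ (by omega) _)
                (abs_nonneg _) zero_le_one
            _ = C2 := one_mul _
      _ = 2 ^ (l + j) * (C1 * C2) := by
          rw [← Finset.sum_mul]
          congr 1
          exact_mod_cast Nat.sum_range_choose (l + j)
      _ ≤ _ := by
          refine mul_le_mul_of_nonneg_right ?_ (by positivity)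
          exact pow_le_pow_right₀ (by norm_num) (by omega)
  · intro l hl y
    simp only [hform]
    have hc : Continuous (fun e : ℝ => ∑ i ∈ Finset.range (l + j + 1),
      ((l + j).choose i : ℝ) * iteratedDeriv i g y *
        (e ^ (l + j - i) * iteratedDeriv (l + j - i) χ (e * y))) := by
      refine continuous_finsetSum _ fun i _ => ?_
      have := hχB.cont (l + j - i)
      fun_prop
    have h2 := (hc.tendsto 0).comp hεl
    have e : (∑ i ∈ Finset.range (l + j + 1),
      ((l + j).choose i : ℝ) * iteratedDeriv i g y *
        ((0:ℝ) ^ (l + j - i) * iteratedDeriv (l + j - i) χ (0 * y))) = iteratedDeriv (l + j) g y := by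
      rw [Finset.sum_eq_single (l + j)]
      · simp [hχ0]
      · intro i hi hne
        have hi' : i ≤ l + j := by simpa [Nat.lt_succ_iff] using hi
        have : l + j - i ≠ 0 := by omega
        rw [zero_pow this]
        simp
      · intro h; simp at h
    rw [← e]
    exact h2
  · intro n
    obtain ⟨f, hf, hfd⟩ := exists_antideriv (hhs n) (hhc n)
    have := H f hf
    simpa only [← add_assoc, iteratedDeriv_succ', hfd] using this

lemma ann_all {Ω : Type*} [MeasurableSpace Ω] (μ : Measure Ω) [IsProbabilityMeasure μ]
    (Y : Ω → ℝ) (hY : Measurable Y) (hYmom : Integrable (fun ω => (Y ω) ^ 2) μ)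
    (T : ℕ) (a₀ a₁ a₂ : ℕ → ℝ) (j : ℕ)
    (H : ∀ f, BB f → ∫ ω, Sq T a₀ a₁ a₂ (fun l => iteratedDeriv (l + j) f (Y ω)) (Y ω) ∂μ = 0) :
    ∀ f, BB f → ∫ ω, Sq T a₀ a₁ a₂ (fun l => iteratedDeriv l f (Y ω)) (Y ω) ∂μ = 0 := by
  induction j with
  | zero => simpa using H
  | succ n ih => exact ih (ann_step μ Y hY hYmom T a₀ a₁ a₂ n H)

lemma Sq_shift (T k : ℕ) (hk : k ≤ T) (a₀ a₁ a₂ : ℕ → ℝ)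
    (h0 : ∀ l < k, a₀ l = 0) (h1 : ∀ l < k, a₁ l = 0) (h2 : ∀ l < k, a₂ l = 0)
    (d : ℕ → ℝ) (y : ℝ) : Sq T a₀ a₁ a₂ d y =
      Sq (T - k) (fun l => a₀ (l + k)) (fun l => a₁ (l + k)) (fun l => a₂ (l + k))
        (fun l => d (l + k)) y := by
  unfold Sq
  obtain ⟨m, rfl⟩ := Nat.exists_eq_add_of_le hk
  rw [show k + m + 1 = k + (m + 1) by ring, Finset.sum_range_add, Finset.sum_eq_zero, zero_add]
  · rw [show k + m - k = m by omega]
    refine Finset.sum_congr rfl fun l _ => ?_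
    rw [add_comm k l]
  · intro l hl
    rw [Finset.mem_range] at hl
    simp [h0 l hl, h1 l hl, h2 l hl]

noncomputable def cc (ε y : ℝ) : ℝ := 1 / (1 + (ε * y) ^ 2)
noncomputable def dd (ε y : ℝ) : ℝ := (ε * y) / (1 + (ε * y) ^ 2)

lemma hasDeriv_cc (ε y : ℝ) : HasDerivAt (cc ε) (ε * (-2 * (cc ε y * dd ε y))) y := by
  have hne : (1 + (ε * y) ^ 2) ≠ 0 := by positivity
  have h1 : HasDerivAt (fun y => 1 + (ε * y) ^ 2) (2 * (ε * y) * ε) y := by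
    have : HasDerivAt (fun y => 1 + (ε * y) ^ 2) _ y :=
      (((hasDerivAt_id y).const_mul ε).pow 2).const_add 1
    refine this.congr_deriv ?_
    simp
  have h := h1.inv hne
  have e : cc ε = (fun y => 1 + (ε * y) ^ 2)⁻¹ := by
    funext x; simp [cc]
  rw [← e] at h
  refine h.congr_deriv ?_
  simp only [cc, dd]
  field_simp

lemma hasDeriv_dd (ε y : ℝ) : HasDerivAt (dd ε) (ε * (cc ε y * cc ε y + -1 * (dd ε y * dd ε y))) y := by
  have hne : (1 + (ε * y) ^ 2) ≠ 0 := by positivity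
  have e : dd ε = fun y => (ε * y) * cc ε y := by
    funext x; simp only [dd, cc]; ring
  have h := ((hasDerivAt_id y).const_mul ε).mul (hasDeriv_cc ε y)
  have h' : HasDerivAt (fun y => (ε * y) * cc ε y)
    (ε * 1 * cc ε y + ε * y * (ε * (-2 * (cc ε y * dd ε y)))) y := h
  rw [e]
  convert h' using 1
  simp only [cc, dd]
  field_simp
  ring

lemma cc_pos (ε y : ℝ) : 0 < cc ε y := by unfold cc; positivity
lemma cc_le (ε y : ℝ) : cc ε y ≤ 1 := by
  unfold cc; rw [div_le_one (by positivity)]; nlinarith [sq_nonneg (ε * y)]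
lemma dd_le (ε y : ℝ) : |dd ε y| ≤ 1 := by
  unfold dd
  rw [abs_div, abs_of_pos (show (0:ℝ) < 1 + (ε * y) ^ 2 by positivity), div_le_one (by positivity)]
  rw [abs_le]; constructor <;> nlinarith [sq_nonneg (ε * y - 1), sq_nonneg (ε * y + 1)]

inductive GG : (ℝ → ℝ → ℝ → ℝ) → Prop
  | const (r : ℝ) : GG (fun _ _ _ => r)
  | es : GG (fun s _ _ => s)
  | ep : GG (fun _ e _ => e)
  | c : GG (fun _ e y => cc e y)
  | d : GG (fun _ e y => dd e y)
  | add {P Q} : GG P → GG Q → GG (fun s e y => P s e y + Q s e y)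
  | mul {P Q} : GG P → GG Q → GG (fun s e y => P s e y * Q s e y)

lemma GG.bdd {Q} (h : GG Q) : ∃ M, 0 ≤ M ∧ ∀ s e y : ℝ, |s| ≤ 1 → 0 < e → e ≤ 1 → |Q s e y| ≤ M := by
  induction h with
  | const r => exact ⟨|r|, abs_nonneg _, fun _ _ _ _ _ _ => le_rfl⟩
  | es => exact ⟨1, zero_le_one, fun _ _ _ h _ _ => h⟩
  | ep => exact ⟨1, zero_le_one, fun _ e _ _ h h' => by rwa [abs_of_pos h]⟩
  | c => exact ⟨1, zero_le_one, fun _ e y _ h h' => by rw [abs_of_pos (cc_pos _ _)]; exact cc_le _ _⟩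
  | d => exact ⟨1, zero_le_one, fun _ e y _ h h' => dd_le _ _⟩
  | add _ _ h1 h2 =>
    obtain ⟨M1, h10, h1⟩ := h1
    obtain ⟨M2, h20, h2⟩ := h2
    exact ⟨M1 + M2, by positivity, fun s e y a b c =>
      (abs_add_le _ _).trans (add_le_add (h1 s e y a b c) (h2 s e y a b c))⟩
  | mul _ _ h1 h2 =>
    obtain ⟨M1, h10, h1⟩ := h1
    obtain ⟨M2, h20, h2⟩ := h2
    exact ⟨M1 * M2, by positivity, fun s e y a b c => by
      rw [abs_mul]
      exact mul_le_mul (h1 s e y a b c) (h2 s e y a b c) (abs_nonneg _) h10⟩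

lemma GG.der {Q} (h : GG Q) : ∃ Q', GG Q' ∧ ∀ s e y : ℝ, HasDerivAt (Q s e) (e * Q' s e y) y := by
  induction h with
  | const r => exact ⟨_, GG.const 0, fun s e y => by simpa using hasDerivAt_const y r⟩
  | es => exact ⟨_, GG.const 0, fun s e y => by simpa using hasDerivAt_const y s⟩
  | ep => exact ⟨_, GG.const 0, fun s e y => by simpa using hasDerivAt_const y e⟩
  | c => exact ⟨_, (GG.const (-2)).mul (GG.c.mul GG.d), fun s e y => hasDeriv_cc e y⟩
  | d => exact ⟨_, (GG.c.mul GG.c).add ((GG.const (-1)).mul (GG.d.mul GG.d)),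
      fun s e y => hasDeriv_dd e y⟩
  | add _ _ h1 h2 =>
    obtain ⟨P', g1, h1⟩ := h1
    obtain ⟨Q', g2, h2⟩ := h2
    refine ⟨_, g1.add g2, fun s e y => ?_⟩
    refine ((h1 s e y).add (h2 s e y)).congr_deriv ?_
    ring
  | @mul P Q p q h1 h2 =>
    obtain ⟨P', g1, h1⟩ := h1
    obtain ⟨Q', g2, h2⟩ := h2
    refine ⟨_, (g1.mul q).add (p.mul g2), fun s e y => ?_⟩
    refine ((h1 s e y).mul (h2 s e y)).congr_deriv ?_
    ring

lemma GG.pow {Q} (h : GG Q) (n : ℕ) : GG (fun s e y => Q s e y ^ n) := by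
  induction n with
  | zero => simpa using GG.const 1
  | succ n ih => simpa only [pow_succ] using ih.mul h

noncomputable def gg (s ε y : ℝ) : ℝ := Real.exp (s / ε * Real.arctan (ε * y))

lemma hasDeriv_gg (s ε y : ℝ) (hε : 0 < ε) : HasDerivAt (gg s ε) (gg s ε y * (s * cc ε y)) y := by
  have h : HasDerivAt (gg s ε) _ y :=
    ((((hasDerivAt_id y).const_mul ε).arctan).const_mul (s / ε)).exp
  refine h.congr_deriv ?_
  simp only [gg, cc, id]
  field_simp

lemma iter_gg (l : ℕ) : ∃ Q, GG Q ∧ ∀ s e : ℝ, 0 < e → iteratedDeriv l (gg s e) =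
    fun y => gg s e y * ((s * cc e y) ^ l + e * s * cc e y * Q s e y) := by
  induction l with
  | zero => exact ⟨_, GG.const 0, fun s e _ => by simp⟩
  | succ n ih =>
    obtain ⟨Q, hQ, ih⟩ := ih
    obtain ⟨Q', hQ', hd⟩ := hQ.der
    refine ⟨_, ((GG.es.mul GG.c).mul hQ).add (((GG.const (-2 * n)).mul
      (((GG.es.mul GG.c).pow (n - 1)).mul GG.d)).add (((GG.ep.mul ((GG.const (-2)).mul GG.d)).mul hQ).add
        (GG.ep.mul hQ'))), fun s e he => ?_⟩
    rw [iteratedDeriv_succ, ih s e he]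
    funext y
    have h1 := hasDeriv_gg s e y he
    have h2 := hasDeriv_cc e y
    have h3 := h1.mul (((h2.const_mul s).pow n).add ((h2.const_mul (e * s)).mul (hd s e y)))
    have h4 : deriv (fun y => gg s e y * ((s * cc e y) ^ n + e * s * cc e y * Q s e y)) y = _ := h3.deriv
    rw [h4]
    simp only [Pi.add_apply, Pi.mul_apply, Pi.pow_apply]
    ring

lemma BB_gg (s ε : ℝ) (hs : |s| ≤ 1) (hε : 0 < ε) (hε1 : ε ≤ 1) : BB (gg s ε) := by
  refine ⟨?_, fun l => ?_⟩
  · unfold gg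
    exact ((Real.contDiff_arctan.comp (by fun_prop : ContDiff ℝ _ fun y : ℝ => ε * y)).const_smul (s / ε)).exp
  · obtain ⟨Q, hQ, h⟩ := iter_gg l
    obtain ⟨M, hM, hb⟩ := (((GG.es.mul GG.c).pow l).add (((GG.ep.mul GG.es).mul GG.c).mul hQ)).bdd
    refine ⟨Real.exp (|s / ε| * (Real.pi / 2)) * M, fun y => ?_⟩
    rw [h s ε hε, abs_mul]
    refine mul_le_mul ?_ (hb s ε y hs hε hε1) (abs_nonneg _) (Real.exp_pos _).le
    rw [gg, Real.abs_exp, Real.exp_le_exp]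
    refine (le_abs_self _).trans ?_
    rw [abs_mul]
    refine mul_le_mul_of_nonneg_left ?_ (abs_nonneg _)
    rw [abs_le]
    exact ⟨(Real.neg_pi_div_two_lt_arctan _).le, (Real.arctan_lt_pi_div_two _).le⟩

lemma abs_arctan_le (x : ℝ) : |Real.arctan x| ≤ |x| := by
  have key : ∀ x : ℝ, 0 ≤ x → Real.arctan x ≤ x := fun x hx => by
    have := Real.le_tan (Real.arctan_nonneg.2 hx) (Real.arctan_lt_pi_div_two x)
    rwa [Real.tan_arctan] at this
  rcases le_total 0 x with h | h
  · rw [abs_of_nonneg h, abs_of_nonneg (Real.arctan_nonneg.2 h)]; exact key x h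
  · rw [abs_of_nonpos h, abs_of_nonpos (Real.arctan_le_zero.2 h), ← Real.arctan_neg]
    exact key _ (by linarith)

lemma gg_tendsto (s y : ℝ) (ε : ℕ → ℝ) (hε0 : ∀ n, 0 < ε n) (hεl : Tendsto ε atTop (𝓝 0)) :
    Tendsto (fun n => gg s (ε n) y) atTop (𝓝 (Real.exp (s * y))) := by
  have h : HasDerivAt (fun e : ℝ => Real.arctan (e * y)) y 0 := by
    have h1 : HasDerivAt (fun e : ℝ => Real.arctan (e * y)) _ 0 :=
      ((hasDerivAt_id (0:ℝ)).mul_const y).arctan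
    refine h1.congr_deriv ?_
    simp
  have h2 := hasDerivAt_iff_tendsto_slope_zero.1 h
  have h3 : Tendsto ε atTop (𝓝[≠] 0) :=
    tendsto_nhdsWithin_iff.2 ⟨hεl, Eventually.of_forall fun n => (hε0 n).ne'⟩
  have h4 := (((h2.comp h3).const_mul s).rexp)
  refine h4.congr fun n => ?_
  simp only [gg, Function.comp]
  simp
  ring

lemma gg_le_exp (s ε y : ℝ) (hs : |s| ≤ 1) (hε : 0 < ε) : gg s ε y ≤ Real.exp |y| := by
  unfold gg
  rw [Real.exp_le_exp]
  refine (le_abs_self _).trans ?_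
  rw [abs_mul, abs_div, abs_of_pos hε]
  have := abs_arctan_le (ε * y)
  rw [abs_mul, abs_of_pos hε] at this
  calc |s| / ε * |Real.arctan (ε * y)| ≤ |s| / ε * (ε * |y|) := by gcongr
    _ = |s| * |y| := by field_simp
    _ ≤ 1 * |y| := by gcongr
    _ = |y| := one_mul _

lemma gg_le_one (s ε y : ℝ) (hsy : s * y ≤ 0) (hε : 0 < ε) : gg s ε y ≤ 1 := by
  unfold gg
  rw [Real.exp_le_one_iff, div_mul_eq_mul_div]
  refine div_nonpos_of_nonpos_of_nonneg ?_ hε.le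
  rcases le_total 0 y with h | h
  · rcases h.eq_or_lt with rfl | h
    · simp
    have : s ≤ 0 := by by_contra hc; push Not at hc; nlinarith [mul_pos hc h]
    exact mul_nonpos_of_nonpos_of_nonneg this (Real.arctan_nonneg.2 (by positivity))
  · rcases h.eq_or_lt with rfl | h
    · simp
    have : 0 ≤ s := by by_contra hc; push Not at hc; nlinarith [mul_pos_of_neg_of_neg hc h]
    exact mul_nonpos_of_nonneg_of_nonpos this (Real.arctan_le_zero.2 (by nlinarith))

lemma eps_sq (ε y : ℝ) (hε : 0 < ε) : y ^ 2 * (ε * cc ε y) ≤ |y| := by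
  have h1 : y ^ 2 * (ε * cc ε y) = y * dd ε y := by unfold cc dd; ring
  rw [h1]
  refine (le_abs_self _).trans ?_
  rw [abs_mul]
  exact mul_le_of_le_one_right (abs_nonneg _) (dd_le _ _)

lemma term_bound (l : ℕ) (u v w M s ε y q : ℝ) (hM : 0 ≤ M) (hq : |q| ≤ M) (hs : |s| ≤ 1)
    (hε : 0 < ε) (hε1 : ε ≤ 1) (h01 : l < 2 → w = 0) (h2 : l = 2 → w = 1) :
    |(u + v * y + w * y ^ 2) * ((s * cc ε y) ^ l + ε * s * cc ε y * q)
      - ((if l = 0 then v * y else 0) + (if l = 2 then y ^ 2 * (s * cc ε y) ^ 2 else 0))|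
      ≤ (|u| + |v| + |w|) * ((1 + M) * (1 + 2 * (|s| * |y|)) + |s| * (y ^ 2 * (s * cc ε y) ^ 2)) := by
  have hc0 := cc_pos ε y
  have hc1 := cc_le ε y
  have hey := eps_sq ε y hε
  set c := cc ε y
  have hsc : |s * c| ≤ |s| := by
    rw [abs_mul, abs_of_pos hc0]; exact mul_le_of_le_one_right (abs_nonneg _) hc1
  set r := ε * s * c * q with hr
  have hr1 : |r| ≤ |s| * M := by
    rw [hr, show ε * s * c * q = ε * ((s * c) * q) by ring, abs_mul, abs_mul (s * c), abs_of_pos hε]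
    calc ε * (|s * c| * |q|) ≤ 1 * (|s| * M) := by gcongr
      _ = _ := one_mul _
  have hr2 : y ^ 2 * |r| ≤ |s| * |y| * M := by
    rw [hr, abs_mul, abs_mul, abs_mul, abs_of_pos hε, abs_of_pos hc0]
    calc y ^ 2 * (ε * |s| * c * |q|) = (y ^ 2 * (ε * c)) * |s| * |q| := by ring
      _ ≤ |y| * |s| * M := by gcongr
      _ = _ := by ring
  have hsn := abs_nonneg s
  have hyn := abs_nonneg y
  have hZ : 0 ≤ y ^ 2 * (s * c) ^ 2 := by positivity
  set Z := y ^ 2 * (s * c) ^ 2 with hZd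
  -- split
  set p := (s * c) ^ l with hp
  have hp1 : |p| ≤ 1 := by
    rw [hp, abs_pow]; exact pow_le_one₀ (abs_nonneg _) (hsc.trans hs)
  have hu : |u * (p + r)| ≤ |u| * (1 + M) := by
    rw [abs_mul]
    refine mul_le_mul_of_nonneg_left ?_ (abs_nonneg _)
    refine (abs_add_le _ _).trans (add_le_add hp1 (hr1.trans ?_))
    nlinarith
  have hv : |v * y * (p + r) - (if l = 0 then v * y else 0)| ≤ |v| * ((1 + M) * (|s| * |y|)) := by
    rcases Nat.eq_zero_or_pos l with h | h
    · subst h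
      have : v * y * (p + r) - (if 0 = 0 then v * y else 0) = v * (y * r) := by
        rw [if_pos rfl, hp]; ring
      rw [this, abs_mul]
      refine mul_le_mul_of_nonneg_left ?_ (abs_nonneg _)
      rw [abs_mul]
      nlinarith [mul_le_mul_of_nonneg_left hr1 hyn, mul_nonneg hsn hyn]
    · rw [if_neg (by omega), sub_zero, mul_assoc, abs_mul]
      refine mul_le_mul_of_nonneg_left ?_ (abs_nonneg _)
      rw [abs_mul]
      have hp2 : |p| ≤ |s| := by
        rw [hp, abs_pow]
        calc |s * c| ^ l ≤ |s * c| ^ 1 := pow_le_pow_of_le_one (abs_nonneg _) (hsc.trans hs) h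
          _ ≤ |s| := by rw [pow_one]; exact hsc
      have : |p + r| ≤ |s| * (1 + M) := by
        refine (abs_add_le _ _).trans ?_
        linarith
      nlinarith [mul_le_mul_of_nonneg_left this hyn]
  have hw : |w * y ^ 2 * (p + r) - (if l = 2 then Z else 0)| ≤
      |w| * (|s| * |y| * M + |s| * Z) := by
    rcases lt_trichotomy l 2 with h | h | h
    · rw [h01 h, if_neg (by omega)]; simp
    · rw [h2 h, if_pos h, hp, h]
      rw [show 1 * y ^ 2 * ((s * c) ^ 2 + r) - Z = y ^ 2 * r by rw [hZd]; ring, abs_mul,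
        abs_of_nonneg (sq_nonneg y), abs_one, one_mul]
      have : 0 ≤ |s| * Z := by positivity
      linarith
    · rw [if_neg (by omega), sub_zero, mul_assoc, abs_mul, mul_add]
      refine mul_le_mul_of_nonneg_left ?_ (abs_nonneg _)
      refine (abs_add_le _ _).trans ?_
      rw [abs_mul, abs_mul, abs_of_nonneg (sq_nonneg y)]
      have : y ^ 2 * |p| ≤ |s| * Z := by
        have : |p| ≤ |s| * (s * c) ^ 2 := by
          rw [hp, abs_pow, ← sq_abs (s * c)]
          calc |s * c| ^ l ≤ |s * c| ^ 3 := pow_le_pow_of_le_one (abs_nonneg _) (hsc.trans hs) h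
            _ = |s * c| * |s * c| ^ 2 := by ring
            _ ≤ _ := by gcongr
        calc y ^ 2 * |p| ≤ y ^ 2 * (|s| * (s * c) ^ 2) := by gcongr
          _ = _ := by rw [hZd]; ring
      linarith
  have hsplit : (u + v * y + w * y ^ 2) * (p + r)
      - ((if l = 0 then v * y else 0) + (if l = 2 then Z else 0))
      = u * (p + r) + (v * y * (p + r) - (if l = 0 then v * y else 0))
        + (w * y ^ 2 * (p + r) - (if l = 2 then Z else 0)) := by ring
  rw [hsplit]
  refine (abs_add_three _ _ _).trans ?_
  set t := |s| * |y|
  have ht : 0 ≤ t := by positivity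
  have hsZ : 0 ≤ |s| * Z := by positivity
  calc _ ≤ |u| * (1 + M) + |v| * ((1 + M) * t) + |w| * (t * M + |s| * Z) :=
        add_le_add (add_le_add hu hv) hw
    _ ≤ |u| * ((1 + M) * (1 + 2 * t) + |s| * Z) + |v| * ((1 + M) * (1 + 2 * t) + |s| * Z)
        + |w| * ((1 + M) * (1 + 2 * t) + |s| * Z) := by
        have hMt : 0 ≤ M * t := mul_nonneg hM ht
        refine add_le_add (add_le_add ?_ ?_) ?_ <;>
          refine mul_le_mul_of_nonneg_left ?_ (abs_nonneg _) <;> nlinarith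
    _ = _ := by ring

lemma Sq_low (T : ℕ) (hT : 2 ≤ T) (a₀ a₁ a₂ : ℕ → ℝ) (h20 : a₂ 0 = 0) (h21 : a₂ 1 = 0)
    (h22 : a₂ 2 = 1) (M s ε y : ℝ) (q : ℕ → ℝ) (hM : 0 ≤ M) (hq : ∀ l ≤ T, |q l| ≤ M)
    (hs : |s| ≤ 1) (hε : 0 < ε) (hε1 : ε ≤ 1) :
    |Sq T a₀ a₁ a₂ (fun l => (s * cc ε y) ^ l + ε * s * cc ε y * q l) y
      - (a₁ 0 * y + y ^ 2 * (s * cc ε y) ^ 2)|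
      ≤ Asum T a₀ a₁ a₂ * ((1 + M) * (1 + 2 * (|s| * |y|)) + |s| * (y ^ 2 * (s * cc ε y) ^ 2)) := by
  have e : a₁ 0 * y + y ^ 2 * (s * cc ε y) ^ 2 = ∑ l ∈ Finset.range (T + 1),
      ((if l = 0 then a₁ l * y else 0) + (if l = 2 then y ^ 2 * (s * cc ε y) ^ 2 else 0)) := by
    rw [Finset.sum_add_distrib, Finset.sum_ite_eq' , Finset.sum_ite_eq', if_pos, if_pos] <;> simp
    omega
  rw [e]
  unfold Sq Asum
  rw [← Finset.sum_sub_distrib, Finset.sum_mul]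
  refine (Finset.abs_sum_le_sum_abs _ _).trans (Finset.sum_le_sum fun l hl => ?_)
  refine term_bound l _ _ _ M s ε y (q l) hM (hq l (by simpa [Nat.lt_succ_iff] using hl)) hs hε hε1 ?_ ?_
  · intro h; interval_cases l <;> assumption
  · rintro rfl; exact h22

lemma arith_E (A M s y Z P κ : ℝ) (hA : 0 ≤ A) (hs : 0 ≤ s) (hy : 0 ≤ y) (hZ : 0 ≤ Z)
    (hs2 : s * (A + 1) ≤ 1) (hs3 : s * (4 * (A * (1 + M) + 1)) ≤ κ)
    (h3 : 2 * (1 + A * (1 + M)) ≤ κ * y)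
    (hl : -(A * ((1 + M) * (1 + 2 * (s * y)) + s * Z)) ≤ P - (κ * y + Z)) : 1 ≤ P := by
  have h1 : A * (s * Z) ≤ Z := by
    have : s * A ≤ 1 := by linarith
    have := mul_le_mul_of_nonneg_right this hZ
    linarith
  have h2 : A * ((1 + M) * (2 * (s * y))) ≤ κ * y / 2 := by
    have : A * (1 + M) * (2 * s) ≤ κ / 2 := by linarith
    have := mul_le_mul_of_nonneg_right this hy
    linarith
  linarith

lemma exp_moment_norm {Ω : Type*} [MeasurableSpace Ω] (μ : Measure Ω) [IsProbabilityMeasure μ]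
    (Y : Ω → ℝ) (hY : Measurable Y) (hYmom : Integrable (fun ω => (Y ω) ^ 2) μ)
    (T : ℕ) (hT : 2 ≤ T) (a₀ a₁ a₂ : ℕ → ℝ) (h20 : a₂ 0 = 0) (h21 : a₂ 1 = 0)
    (h22 : a₂ 2 = 1) (hκ : a₁ 0 ≠ 0)
    (H : ∀ f, BB f → ∫ ω, Sq T a₀ a₁ a₂ (fun l => iteratedDeriv l f (Y ω)) (Y ω) ∂μ = 0) :
    ∃ s₀ > 0, ∀ s, 0 < s * a₁ 0 → |s| ≤ s₀ → Integrable (fun ω => Real.exp (s * Y ω)) μ := by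
  choose Q hQG hQ using iter_gg
  choose m hm0 hm using fun l => (hQG l).bdd
  set M := ∑ l ∈ Finset.range (T + 1), m l with hMd
  have hM0 : 0 ≤ M := Finset.sum_nonneg fun l _ => hm0 l
  have hM : ∀ s e y : ℝ, |s| ≤ 1 → 0 < e → e ≤ 1 → ∀ l ≤ T, |Q l s e y| ≤ M := by
    intro s e y h1 h2 h3 l hl
    refine (hm l s e y h1 h2 h3).trans ?_
    exact Finset.single_le_sum (f := m) (fun i _ => hm0 i) (Finset.mem_range.2 (by omega))
  set A := Asum T a₀ a₁ a₂ with hAd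
  have hA0 : 0 ≤ A := Asum_nonneg _ _ _ _
  set κ := a₁ 0 with hκd
  have hκp : 0 < |κ| := abs_pos.2 hκ
  set B := A * (1 + M) with hBd
  have hB0 : 0 ≤ B := by positivity
  set K := 2 * (1 + B) / |κ| with hK
  have hK0 : 0 ≤ K := by positivity
  set C := Real.exp K * (B + 1) with hC
  have hE1 : 1 ≤ Real.exp K := Real.one_le_exp hK0
  refine ⟨min 1 (min (1 / (A + 1)) (|κ| / (4 * (B + 1)))), by positivity, fun s hsκ hs => ?_⟩
  obtain ⟨hs1, hs'⟩ := le_min_iff.1 hs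
  obtain ⟨hs2, hs3⟩ := le_min_iff.1 hs'
  rw [le_div_iff₀ (by positivity)] at hs2 hs3
  have hsn := abs_nonneg s
  have hpt : ∀ ε y, 0 < ε → ε ≤ 1 → gg s ε y - C * (1 + y ^ 2) ≤
      Sq T a₀ a₁ a₂ (fun l => iteratedDeriv l (gg s ε) y) y := by
    intro ε y hε hε1
    have hg0 : 0 < gg s ε y := Real.exp_pos _
    set P := Sq T a₀ a₁ a₂ (fun l => (s * cc ε y) ^ l + ε * s * cc ε y * Q l s ε y) y with hP
    have e1 : Sq T a₀ a₁ a₂ (fun l => iteratedDeriv l (gg s ε) y) y = gg s ε y * P := by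
      rw [hP]; unfold Sq
      rw [Finset.mul_sum]
      refine Finset.sum_congr rfl fun l _ => ?_
      simp only [hQ l s ε hε]; ring
    rw [e1]
    have hup : |P| ≤ B * (1 + y ^ 2) := by
      refine Sq_bound _ _ _ _ _ _ _ fun l hl => ?_
      have hsc : |s * cc ε y| ≤ 1 := by
        rw [abs_mul, abs_of_pos (cc_pos _ _)]
        exact mul_le_one₀ hs1 (cc_pos _ _).le (cc_le _ _)
      refine (abs_add_le _ _).trans (add_le_add ?_ ?_)
      · rw [abs_pow]; exact pow_le_one₀ (abs_nonneg _) hsc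
      · rw [show ε * s * cc ε y * Q l s ε y = ε * ((s * cc ε y) * Q l s ε y) by ring, abs_mul,
          abs_mul, abs_of_pos hε]
        calc _ ≤ 1 * (1 * M) := by
              gcongr
              exact hM s ε y hs1 hε hε1 l hl
          _ = M := by ring
    have hlow := (abs_le.1 hup).1
    have hbd : ∀ G, 1 ≤ G → G ≤ Real.exp K → gg s ε y ≤ G → gg s ε y - C * (1 + y ^ 2) ≤ gg s ε y * P := by
      intro G hG1 hG2 hG
      have h1 : gg s ε y * (B * (1 + y ^ 2)) ≤ Real.exp K * (B * (1 + y ^ 2)) := by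
        gcongr; exact hG.trans hG2
      have h2 : gg s ε y * (-(B * (1 + y ^ 2))) ≤ gg s ε y * P :=
        mul_le_mul_of_nonneg_left hlow hg0.le
      have h3 : gg s ε y ≤ Real.exp K * (1 + y ^ 2) := by nlinarith [sq_nonneg y]
      rw [hC]; nlinarith
    rcases lt_or_ge (s * y) 0 with hsy | hsy
    · exact hbd 1 le_rfl hE1 (gg_le_one _ _ _ hsy.le hε)
    rcases le_or_gt |y| K with hyK | hyK
    · exact hbd _ hE1 le_rfl ((gg_le_exp s ε y hs1 hε).trans (Real.exp_le_exp.2 hyK))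
    have hky : κ * y = |κ| * |y| := by
      rw [← abs_mul, abs_of_nonneg]
      have : 0 ≤ (s * κ) * (s * y) := mul_nonneg hsκ.le hsy
      have hs0 : 0 < s ^ 2 := by
        have : s ≠ 0 := by rintro rfl; simp at hsκ
        positivity
      by_contra hc; push Not at hc
      nlinarith [mul_pos hs0 (neg_pos.2 hc)]
    have hl := (abs_le.1 (Sq_low T hT a₀ a₁ a₂ h20 h21 h22 M s ε y (fun l => Q l s ε y) hM0
      (hM s ε y hs1 hε hε1) hs1 hε hε1)).1
    rw [← hP, ← hAd, ← hκd, hky] at hl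
    set Z := y ^ 2 * (s * cc ε y) ^ 2
    have hZ : 0 ≤ Z := by positivity
    have h3 : 2 * (1 + B) ≤ |κ| * |y| := by
      have := (div_lt_iff₀ hκp).1 hyK
      linarith
    have hP1 : 1 ≤ P := arith_E A M |s| |y| Z P |κ| hA0 hsn (abs_nonneg y) hZ hs2 hs3 h3 hl
    have h5 : 0 ≤ C * (1 + y ^ 2) := by positivity
    have h6 := mul_le_mul_of_nonneg_left hP1 hg0.le
    linarith
  -- integrate
  have hint : ∀ ε, 0 < ε → ε ≤ 1 → Integrable (fun ω => gg s ε (Y ω)) μ ∧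
      ∫ ω, gg s ε (Y ω) ∂μ ≤ ∫ ω, C * (1 + Y ω ^ 2) ∂μ := by
    intro ε hε hε1
    have hb := BB_gg s ε hs1 hε hε1
    have hm := BB_mem μ Y hY hYmom hb T
    have hi : Integrable (fun ω => gg s ε (Y ω)) μ := by
      simpa using hm.2 0 (by omega) 0 (by omega)
    have hiC : Integrable (fun ω => C * (1 + Y ω ^ 2)) μ :=
      ((integrable_const (1 : ℝ)).add hYmom).const_mul C
    have hiS : Integrable (fun ω => Sq T a₀ a₁ a₂ (fun l => iteratedDeriv l (gg s ε) (Y ω)) (Y ω)) μ := by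
      unfold Sq
      refine integrable_finsetSum _ fun l hl => ?_
      have hl' : l ≤ T := by simpa [Nat.lt_succ_iff] using hl
      have := ((hm.2 l hl' 0 (by omega)).const_mul (a₀ l)).add
        (((hm.2 l hl' 1 (by omega)).const_mul (a₁ l)).add ((hm.2 l hl' 2 (by omega)).const_mul (a₂ l)))
      refine this.congr (Eventually.of_forall fun ω => ?_)
      simp only [Pi.add_apply]; ring
    refine ⟨hi, ?_⟩
    have := integral_mono (hi.sub hiC) hiS (fun ω => hpt ε (Y ω) hε hε1)
    rw [H _ hb] at this
    have e : ∫ ω, (gg s ε (Y ω) - C * (1 + Y ω ^ 2)) ∂μ = _ := integral_sub hi hiC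
    have e2 : ∫ ω, (gg s ε (Y ω) - C * (1 + Y ω ^ 2)) ∂μ ≤ 0 := this
    rw [e] at e2
    linarith
  let ε : ℕ → ℝ := fun n => 1 / ((n : ℝ) + 1)
  have hε0 : ∀ n, 0 < ε n := fun n => by simp only [ε]; positivity
  have hε1 : ∀ n, ε n ≤ 1 := fun n => by
    simp only [ε]; rw [div_le_one (by positivity)]; linarith [(Nat.cast_nonneg n : (0:ℝ) ≤ n)]
  have hεl : Tendsto ε atTop (𝓝 0) := tendsto_one_div_add_atTop_nhds_zero_nat
  refine ⟨by fun_prop, ?_⟩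
  have hF : ∫⁻ ω, ‖Real.exp (s * Y ω)‖ₑ ∂μ ≤
      liminf (fun n => ∫⁻ ω, ‖gg s (ε n) (Y ω)‖ₑ ∂μ) atTop := by
    refine le_trans (le_of_eq ?_) (lintegral_liminf_le'
      fun n => (hint (ε n) (hε0 n) (hε1 n)).1.1.aemeasurable.enorm)
    refine lintegral_congr fun ω => ?_
    exact (gg_tendsto s (Y ω) ε hε0 hεl).enorm.liminf_eq.symm
  refine lt_of_le_of_lt (hF.trans ?_) (ENNReal.ofReal_lt_top (r := ∫ ω, C * (1 + Y ω ^ 2) ∂μ))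
  refine liminf_le_of_frequently_le' (Eventually.of_forall fun n => ?_).frequently
  obtain ⟨h1, h2⟩ := hint (ε n) (hε0 n) (hε1 n)
  refine le_trans (le_of_eq ?_) (ENNReal.ofReal_le_ofReal h2)
  rw [ofReal_integral_eq_lintegral_ofReal h1 (Eventually.of_forall fun ω => (Real.exp_pos _).le)]
  refine lintegral_congr fun ω => ?_
  exact Real.enorm_of_nonneg (Real.exp_pos _).le

lemma exp_moment {Ω : Type*} [MeasurableSpace Ω] (μ : Measure Ω) [IsProbabilityMeasure μ]
    (Y : Ω → ℝ) (hY : Measurable Y) (hYmom : Integrable (fun ω => (Y ω) ^ 2) μ)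
    (T : ℕ) (hT : 2 ≤ T) (a₀ a₁ a₂ : ℕ → ℝ) (h20 : a₂ 0 = 0) (h21 : a₂ 1 = 0)
    (h22 : a₂ 2 ≠ 0) (hκ : a₁ 0 ≠ 0)
    (H : ∀ f, BB f → ∫ ω, Sq T a₀ a₁ a₂ (fun l => iteratedDeriv l f (Y ω)) (Y ω) ∂μ = 0) :
    ∃ s₀ > 0, ∀ s, 0 < s * (a₁ 0 / a₂ 2) → |s| ≤ s₀ → Integrable (fun ω => Real.exp (s * Y ω)) μ := by
  refine exp_moment_norm μ Y hY hYmom T hT (fun l => a₀ l / a₂ 2) (fun l => a₁ l / a₂ 2)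
    (fun l => a₂ l / a₂ 2) (by simp [h20]) (by simp [h21]) (div_self h22) (div_ne_zero hκ h22) ?_
  intro f hf
  have e : ∀ (d : ℕ → ℝ) y, Sq T (fun l => a₀ l / a₂ 2) (fun l => a₁ l / a₂ 2)
    (fun l => a₂ l / a₂ 2) d y = (a₂ 2)⁻¹ * Sq T a₀ a₁ a₂ d y := by
    intro d y
    unfold Sq
    rw [Finset.mul_sum]
    refine Finset.sum_congr rfl fun l _ => ?_
    ring
  simp only [e]
  rw [integral_const_mul, H f hf, mul_zero]

lemma poly_low_real (T : ℕ) (c : ℕ → ℝ) (d : ℕ) (hd : d ≤ T) (h0 : ∀ l < d, c l = 0) :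
    Tendsto (fun t : ℝ => (∑ l ∈ Finset.range (T + 1), c l * t ^ l) / t ^ d)
      (𝓝[≠] (0 : ℝ)) (𝓝 (c d)) := by
  have h := (Complex.continuous_re.tendsto _).comp
    (poly_low T (fun l => (c l : ℂ)) d hd (fun l hl => by simp [h0 l hl]))
  refine h.congr fun t => ?_
  have : (∑ l ∈ Finset.range (T + 1), (c l : ℂ) * (t : ℂ) ^ l) / (t : ℂ) ^ d =
      (((∑ l ∈ Finset.range (T + 1), c l * t ^ l) / t ^ d : ℝ) : ℂ) := by push_cast; rfl
  simp only [Function.comp, this, Complex.ofReal_re]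

lemma ratio_arith (p1 p2 σ s : ℝ) (k : ℕ) (hσ : σ ≠ 0) (hp : p2 ≠ 0) :
    s * (p1 / σ ^ k / (p2 / σ ^ (k + 2))) = (s * (p1 / p2)) * σ ^ 2 := by
  rw [pow_add]
  field_simp

lemma poly_ratio (T k : ℕ) (a₁ a₂ : ℕ → ℝ) (hk : k + 2 ≤ T) (h2 : ∀ l < k + 2, a₂ l = 0)
    (h1 : ∀ l < k, a₁ l = 0) (h22 : a₂ (k + 2) ≠ 0) (s : ℝ) (hs : 0 < s * (a₁ k / a₂ (k + 2))) :
    ∃ δ > 0, δ ≤ 1 / 2 ∧ ∀ τ, 0 < τ → τ < δ →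
      (∑ l ∈ Finset.range (T + 1), a₂ l * (s * τ) ^ l) ≠ 0 ∧
      (s * (a₁ k / a₂ (k + 2)) / (2 * s ^ 2)) / τ ^ 2 ≤
        s * ((∑ l ∈ Finset.range (T + 1), a₁ l * (s * τ) ^ l) /
          (∑ l ∈ Finset.range (T + 1), a₂ l * (s * τ) ^ l)) := by
  have hs0 : s ≠ 0 := by rintro rfl; simp at hs
  have L1 := poly_low_real T a₁ k (by omega) h1
  have L2 := poly_low_real T a₂ (k + 2) hk h2
  have L3 := (L1.div L2 h22).const_mul s
  have E1 := L2.eventually_ne h22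
  have E2 := L3.eventually (lt_mem_nhds (show s * (a₁ k / a₂ (k + 2)) / 2 < s * (a₁ k / a₂ (k + 2)) by linarith))
  obtain ⟨r, hr, hball⟩ := Metric.mem_nhdsWithin_iff.1 (E1.and E2)
  refine ⟨min (1 / 2) (r / |s|), by positivity, min_le_left _ _, fun τ h0 hτ => ?_⟩
  have hτ2 := (lt_div_iff₀ (abs_pos.2 hs0)).1 (lt_min_iff.1 hτ).2
  have hσ : s * τ ≠ 0 := mul_ne_zero hs0 h0.ne'
  obtain ⟨g1, g2⟩ := hball (a := s * τ) ⟨by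
    rw [Metric.mem_ball, dist_zero_right, Real.norm_eq_abs, abs_mul, abs_of_pos h0]; linarith, hσ⟩
  simp only [Pi.div_apply] at g2
  generalize (∑ l ∈ Finset.range (T + 1), a₂ l * (s * τ) ^ l) = p2 at *
  generalize (∑ l ∈ Finset.range (T + 1), a₁ l * (s * τ) ^ l) = p1 at *
  have hp2 : p2 ≠ 0 := by rintro rfl; simp at g1
  refine ⟨hp2, ?_⟩
  rw [ratio_arith _ _ _ _ _ hσ hp2] at g2
  have hpos : 0 < (s * τ) ^ 2 := by positivity
  have := (div_lt_iff₀ hpos).2 g2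
  refine le_trans (le_of_eq ?_) this.le
  field_simp

lemma ode_unique (M M1 M2 N N1 N2 q : ℝ → ℝ) (δ c C : ℝ) (hδ : 0 < δ) (hc : 0 < c)
    (hM : ∀ t ∈ Ioo 0 δ, HasDerivAt M (M1 t) t) (hM1 : ∀ t ∈ Ioo 0 δ, HasDerivAt M1 (M2 t) t)
    (hN : ∀ t ∈ Ioo 0 δ, HasDerivAt N (N1 t) t) (hN1 : ∀ t ∈ Ioo 0 δ, HasDerivAt N1 (N2 t) t)
    (hw : ∀ t ∈ Ioo 0 δ, M t * N2 t - M2 t * N t = -(q t) * (M t * N1 t - M1 t * N t))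
    (hq : ∀ t ∈ Ioo 0 δ, c / t ^ 2 ≤ q t)
    (hb : ∀ t ∈ Ioo 0 δ, |M t * N1 t - M1 t * N t| ≤ C)
    (hpos : ∀ t ∈ Ioo 0 δ, 0 < M t)
    (hMl : Tendsto M (𝓝[>] 0) (𝓝 1)) (hNl : Tendsto N (𝓝[>] 0) (𝓝 1)) :
    ∀ t ∈ Ioo 0 δ, M t = N t := by
  set w : ℝ → ℝ := fun t => M t * N1 t - M1 t * N t with hwd
  have hwder : ∀ t ∈ Ioo 0 δ, HasDerivAt w (-(q t) * w t) t := by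
    intro t ht
    have h : HasDerivAt w _ t := ((hM t ht).mul (hN1 t ht)).sub ((hM1 t ht).mul (hN t ht))
    refine h.congr_deriv ?_
    rw [← hw t ht]; ring
  set z : ℝ → ℝ := fun t => w t ^ 2 * Real.exp (-(2 * c) * t⁻¹) with hz
  have hzder : ∀ t ∈ Ioo 0 δ, HasDerivAt z
      (2 * w t ^ 2 * Real.exp (-(2 * c) * t⁻¹) * (c / t ^ 2 - q t)) t := by
    intro t ht
    have h : HasDerivAt z _ t := ((hwder t ht).pow 2).mul
      (((hasDerivAt_inv ht.1.ne').const_mul (-(2 * c))).exp)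
    refine h.congr_deriv ?_
    simp only [Pi.pow_apply]
    field_simp
    ring
  have hanti : AntitoneOn z (Ioo 0 δ) := by
    refine antitoneOn_of_hasDerivWithinAt_nonpos (convex_Ioo 0 δ)
      (fun t ht => (hzder t ht).continuousAt.continuousWithinAt)
      (f' := fun t => 2 * w t ^ 2 * Real.exp (-(2 * c) * t⁻¹) * (c / t ^ 2 - q t)) ?_ ?_
    · intro t ht; rw [interior_Ioo] at ht; exact (hzder t ht).hasDerivWithinAt
    · intro t ht; rw [interior_Ioo] at ht
      exact mul_nonpos_of_nonneg_of_nonpos (by positivity) (by linarith [hq t ht])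
  have hev : ∀ t ∈ Ioo 0 δ, ∀ᶠ u in 𝓝[>] (0:ℝ), u ∈ Ioo 0 t := fun t ht => Ioo_mem_nhdsGT ht.1
  have hexp : Tendsto (fun t : ℝ => C ^ 2 * Real.exp (-(2 * c) * t⁻¹)) (𝓝[>] 0) (𝓝 0) := by
    have h1 : Tendsto (fun t : ℝ => -(2 * c) * t⁻¹) (𝓝[>] 0) atBot :=
      tendsto_inv_nhdsGT_zero.const_mul_atTop_of_neg (by linarith)
    simpa using (Real.tendsto_exp_atBot.comp h1).const_mul (C ^ 2)
  have hw0 : ∀ t ∈ Ioo 0 δ, w t = 0 := by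
    intro t ht
    have : z t ≤ 0 := by
      refine ge_of_tendsto hexp ?_
      filter_upwards [hev t ht] with u hu
      have hu' : u ∈ Ioo 0 δ := ⟨hu.1, hu.2.trans ht.2⟩
      refine (hanti hu' ht hu.2.le).trans ?_
      rw [hz]
      refine mul_le_mul_of_nonneg_right ?_ (Real.exp_pos _).le
      rw [← sq_abs (w u)]
      exact pow_le_pow_left₀ (abs_nonneg _) (hb u hu') 2
    have h2 : w t ^ 2 ≤ 0 := by
      by_contra h; push Not at h
      have := mul_pos h (Real.exp_pos (-(2 * c) * t⁻¹))
      rw [hz] at *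
      linarith
    exact pow_eq_zero_iff (two_ne_zero) |>.1 (le_antisymm h2 (sq_nonneg _))
  have hr : ∀ t ∈ Ioo 0 δ, HasDerivAt (fun t => N t / M t) 0 t := by
    intro t ht
    have h : HasDerivAt (fun t => N t / M t) _ t := (hN t ht).div (hM t ht) (hpos t ht).ne'
    refine h.congr_deriv ?_
    have := hw0 t ht
    simp only [hwd] at this
    rw [show N1 t * M t - N t * M1 t = 0 by linarith, zero_div]
  intro t ht
  have hconst : ∀ u ∈ Ioo 0 δ, N u / M u = N t / M t := by
    intro u hu
    exact (convex_Ioo 0 δ).is_const_of_fderivWithin_eq_zero (𝕜 := ℝ)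
      (fun x hx => (hr x hx).differentiableAt.differentiableWithinAt)
      (fun x hx => by
        rw [fderivWithin_of_isOpen isOpen_Ioo hx]
        have := (hr x hx).hasFDerivAt.fderiv
        rw [this]; ext; simp) hu ht
  have hlim := hNl.div hMl one_ne_zero
  have hlim2 : Tendsto (fun _ : ℝ => N t / M t) (𝓝[>] (0:ℝ)) (𝓝 (1 / 1)) := by
    refine hlim.congr' ?_
    filter_upwards [Ioo_mem_nhdsGT hδ] with u hu
    exact hconst u hu
  have := tendsto_nhds_unique hlim2 tendsto_const_nhds
  rw [div_one, eq_div_iff (hpos t ht).ne'] at this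
  linarith

lemma exp_mul_le (τ x : ℝ) (h0 : 0 ≤ τ) (h1 : τ ≤ 1) : Real.exp (τ * x) ≤ 1 + Real.exp x := by
  rcases le_total 0 x with h | h
  · have : Real.exp (τ * x) ≤ Real.exp x := Real.exp_le_exp.2 (by nlinarith)
    linarith
  · have : Real.exp (τ * x) ≤ 1 := Real.exp_le_one_iff.2 (by nlinarith)
    linarith [Real.exp_pos x]

lemma x_exp_mul_le (τ x : ℝ) (h0 : 0 ≤ τ) (h1 : τ ≤ 1 / 2) :
    |x * Real.exp (τ * x)| ≤ 1 + x ^ 2 + 2 * Real.exp x := by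
  rw [abs_mul, abs_of_pos (Real.exp_pos _)]
  have hx2 : |x| ≤ 1 + x ^ 2 := by
    rw [abs_le]; constructor <;> nlinarith [sq_nonneg (x - 1), sq_nonneg (x + 1)]
  rcases le_total 0 x with h | h
  · have h2 : Real.exp (τ * x) ≤ Real.exp (x / 2) := Real.exp_le_exp.2 (by nlinarith)
    have h3 : x / 2 ≤ Real.exp (x / 2) := by linarith [Real.add_one_le_exp (x / 2)]
    have h4 : Real.exp x = Real.exp (x / 2) * Real.exp (x / 2) := by
      rw [← Real.exp_add]; congr 1; ring
    rw [abs_of_nonneg h, h4]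
    have h5 := Real.exp_pos (x / 2)
    have h6 : x * Real.exp (τ * x) ≤ x * Real.exp (x / 2) := mul_le_mul_of_nonneg_left h2 h
    nlinarith [sq_nonneg x, mul_le_mul_of_nonneg_right h3 h5.le]
  · have : Real.exp (τ * x) ≤ 1 := Real.exp_le_one_iff.2 (by nlinarith)
    have := mul_le_mul_of_nonneg_left this (abs_nonneg x)
    linarith [Real.exp_pos x]

section
variable {Ω : Type*} [MeasurableSpace Ω] (μ : Measure Ω) [IsProbabilityMeasure μ] (X : Ω → ℝ)

lemma mem_int (h1 : Integrable (fun ω => Real.exp (X ω)) μ) {t : ℝ} (ht : t ∈ Ioo (0:ℝ) 1) :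
    t ∈ interior (integrableExpSet X μ) := by
  have h0' : (0:ℝ) ∈ integrableExpSet X μ := by simp [integrableExpSet]
  have h1' : (1:ℝ) ∈ integrableExpSet X μ := by simpa [integrableExpSet] using h1
  have hs : Icc (0:ℝ) 1 ⊆ integrableExpSet X μ := convex_integrableExpSet.ordConnected.out h0' h1'
  refine interior_mono hs ?_
  rwa [interior_Icc]

lemma mgf_lim (hX : Measurable X) (h1 : Integrable (fun ω => Real.exp (X ω)) μ) (v : ℝ) :
    Tendsto (fun t : ℝ => complexMGF X μ ((t : ℂ) + v * Complex.I)) (𝓝[>] 0)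
      (𝓝 (complexMGF X μ (v * Complex.I))) := by
  unfold complexMGF
  refine tendsto_integral_filter_of_dominated_convergence (fun ω => 1 + Real.exp (X ω)) ?_ ?_
    ((integrable_const (1:ℝ)).add h1) ?_
  · refine Eventually.of_forall fun t => ?_
    exact (Complex.measurable_exp.comp (by fun_prop)).aestronglyMeasurable
  · filter_upwards [Ioo_mem_nhdsGT (zero_lt_one (α := ℝ))] with t ht
    refine Eventually.of_forall fun ω => ?_
    rw [Complex.norm_exp]
    have : (((t : ℂ) + v * Complex.I) * (X ω : ℂ)).re = t * X ω := by simp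
    rw [this]
    exact exp_mul_le _ _ ht.1.le ht.2.le
  · refine Eventually.of_forall fun ω => ?_
    have hc : Continuous (fun t : ℝ => Complex.exp (((t : ℂ) + v * Complex.I) * (X ω : ℂ))) := by
      fun_prop
    have := (hc.tendsto 0).mono_left (nhdsWithin_le_nhds (s := Ioi 0))
    simpa using this

lemma mgf_lim_real (hX : Measurable X) (h1 : Integrable (fun ω => Real.exp (X ω)) μ) :
    Tendsto (mgf X μ) (𝓝[>] 0) (𝓝 1) := by
  have h := (Complex.continuous_re.tendsto _).comp (mgf_lim μ X hX h1 0)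
  have e : (complexMGF X μ ((0:ℝ) * Complex.I)).re = 1 := by
    simp [complexMGF]
  rw [e] at h
  refine h.congr fun t => ?_
  simp only [Function.comp, Complex.ofReal_zero, zero_mul, add_zero, complexMGF_ofReal,
    Complex.ofReal_re]

lemma mgf_bd (hX : Measurable X) (h2 : Integrable (fun ω => X ω ^ 2) μ)
    (h1 : Integrable (fun ω => Real.exp (X ω)) μ) : ∃ C, 0 ≤ C ∧ ∀ t, 0 ≤ t → t ≤ 1 / 2 →
      |mgf X μ t| ≤ C ∧ |∫ ω, X ω * Real.exp (t * X ω) ∂μ| ≤ C := by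
  have hi : Integrable (fun ω => 1 + X ω ^ 2 + 2 * Real.exp (X ω)) μ :=
    ((integrable_const (1:ℝ)).add h2).add (h1.const_mul 2)
  refine ⟨∫ ω, (1 + X ω ^ 2 + 2 * Real.exp (X ω)) ∂μ,
    integral_nonneg fun ω => by positivity, fun t ht0 ht1 => ⟨?_, ?_⟩⟩
  · rw [← Real.norm_eq_abs]
    refine norm_integral_le_of_norm_le hi (Eventually.of_forall fun ω => ?_)
    simp only [Real.norm_eq_abs, abs_of_pos (Real.exp_pos _)]
    have := exp_mul_le t (X ω) ht0 (by linarith)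
    nlinarith [Real.exp_pos (X ω), sq_nonneg (X ω)]
  · rw [← Real.norm_eq_abs]
    refine norm_integral_le_of_norm_le hi (Eventually.of_forall fun ω => ?_)
    exact x_exp_mul_le _ _ ht0 ht1
end

lemma law_eq {Ω Ω' : Type*} [MeasurableSpace Ω] [MeasurableSpace Ω']
    (μ : Measure Ω) [IsProbabilityMeasure μ] (ν : Measure Ω') [IsProbabilityMeasure ν]
    (X : Ω → ℝ) (hX : Measurable X) (h1 : Integrable (fun ω => Real.exp (X ω)) μ)
    (Z : Ω' → ℝ) (hZ : Measurable Z) (h1' : Integrable (fun ω => Real.exp (Z ω)) ν)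
    (δ : ℝ) (hδ : 0 < δ) (hδ1 : δ ≤ 1 / 2) (h : ∀ t ∈ Ioo 0 δ, mgf X μ t = mgf Z ν t) :
    Measure.map X μ = Measure.map Z ν := by
  set U : Set ℂ := {z | z.re ∈ Ioo (0:ℝ) 1} with hU
  have aX : AnalyticOnNhd ℂ (complexMGF X μ) U := fun z hz =>
    analyticOnNhd_complexMGF z (mem_int μ X h1 hz)
  have aZ : AnalyticOnNhd ℂ (complexMGF Z ν) U := fun z hz =>
    analyticOnNhd_complexMGF z (mem_int ν Z h1' hz)
  have hpre : IsPreconnected U := ((convex_Ioo (0:ℝ) 1).linear_preimage Complex.reLm).isPreconnected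
  have hEq : EqOn (complexMGF X μ) (complexMGF Z ν) U := by
    refine aX.eqOn_of_preconnected_of_frequently_eq aZ hpre (z₀ := ((δ / 2 : ℝ) : ℂ)) ?_ ?_
    · simp only [hU, mem_ofPred_eq, Complex.ofReal_re]; constructor <;> linarith
    · have h_real : ∃ᶠ (x : ℝ) in 𝓝[≠] (δ / 2), complexMGF X μ x = complexMGF Z ν x := by
        refine Eventually.frequently ?_
        have : Ioo 0 δ ∈ 𝓝 (δ / 2) := Ioo_mem_nhds (by linarith) (by linarith)
        filter_upwards [nhdsWithin_le_nhds this] with x hx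
        rw [complexMGF_ofReal, complexMGF_ofReal, h x hx]
      rw [frequently_iff_seq_forall] at h_real ⊢
      obtain ⟨xs, hx_tendsto, hx_eq⟩ := h_real
      refine ⟨fun n ↦ xs n, ?_, fun n ↦ ?_⟩
      · rw [tendsto_nhdsWithin_iff] at hx_tendsto ⊢
        constructor
        · exact (Complex.continuous_ofReal.tendsto _).comp hx_tendsto.1
        · have := hx_tendsto.2
          filter_upwards [this] with n hn
          simp only [mem_compl_iff, mem_singleton_iff] at hn ⊢
          exact_mod_cast hn
      · exact hx_eq n
  have : IsProbabilityMeasure (Measure.map X μ) := Measure.isProbabilityMeasure_map hX.aemeasurable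
  have : IsProbabilityMeasure (Measure.map Z ν) := Measure.isProbabilityMeasure_map hZ.aemeasurable
  refine Measure.ext_of_charFun ?_
  funext v
  rw [← complexMGF_mul_I hX.aemeasurable, ← complexMGF_mul_I hZ.aemeasurable]
  refine tendsto_nhds_unique (mgf_lim μ X hX h1 v) ((mgf_lim ν Z hZ h1' v).congr' ?_)
  filter_upwards [Ioo_mem_nhdsGT (zero_lt_one (α := ℝ))] with t ht
  refine (hEq ?_).symm
  simpa [hU] using ht

lemma int_Yexp {Ω : Type*} [MeasurableSpace Ω] (μ : Measure Ω) [IsProbabilityMeasure μ] (Y : Ω → ℝ)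
    (s : ℝ) (hs : s ≠ 0) (h1 : Integrable (fun ω => Real.exp (s * Y ω)) μ) {t : ℝ}
    (ht : t ∈ Ioo (0:ℝ) 1) (n : ℕ) :
    Integrable (fun ω => Y ω ^ n * Real.exp (s * t * Y ω)) μ ∧
      ∫ ω, Y ω ^ n * Real.exp (s * t * Y ω) ∂μ =
        (∫ ω, (s * Y ω) ^ n * Real.exp (t * (s * Y ω)) ∂μ) / s ^ n := by
  have e : ∀ ω, Y ω ^ n * Real.exp (s * t * Y ω) =
      (s * Y ω) ^ n * Real.exp (t * (s * Y ω)) / s ^ n := by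
    intro ω
    rw [show t * (s * Y ω) = s * t * Y ω by ring, mul_pow]
    field_simp
  have hi := integrable_pow_mul_exp_of_mem_interior_integrableExpSet
    (mem_int μ (fun ω => s * Y ω) h1 ht) n
  simp only [e]
  exact ⟨hi.div_const _, integral_div _ _⟩

lemma mem_exp {Ω : Type*} [MeasurableSpace Ω] (μ : Measure Ω) [IsProbabilityMeasure μ] (Y : Ω → ℝ)
    (s : ℝ) (hs : s ≠ 0) (h1 : Integrable (fun ω => Real.exp (s * Y ω)) μ) {t : ℝ}
    (ht : t ∈ Ioo (0:ℝ) 1) (T : ℕ) : memFquad μ Y T (fun y => Real.exp (s * t * y)) := by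
  refine ⟨by fun_prop, fun l _ j _ => ?_⟩
  rw [iteratedDeriv_exp_const_mul]
  refine ((int_Yexp μ Y s hs h1 ht j).1.const_mul ((s * t) ^ l)).congr
    (Eventually.of_forall fun ω => ?_)
  ring

lemma stein_exp {Ω : Type*} [MeasurableSpace Ω] (μ : Measure Ω) [IsProbabilityMeasure μ] (Y : Ω → ℝ)
    (s : ℝ) (hs : s ≠ 0) (h1 : Integrable (fun ω => Real.exp (s * Y ω)) μ) {t : ℝ}
    (ht : t ∈ Ioo (0:ℝ) 1) (T : ℕ) (a₀ a₁ a₂ : ℕ → ℝ)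
    (H : ∫ ω, steinQuad T a₀ a₁ a₂ (fun y => Real.exp (s * t * y)) (Y ω) ∂μ = 0) :
    (∑ l ∈ Finset.range (T + 1), a₀ l * (s * t) ^ l) * mgf (fun ω => s * Y ω) μ t +
    (∑ l ∈ Finset.range (T + 1), a₁ l * (s * t) ^ l) *
      ((∫ ω, (s * Y ω) * Real.exp (t * (s * Y ω)) ∂μ) / s) +
    (∑ l ∈ Finset.range (T + 1), a₂ l * (s * t) ^ l) *
      ((∫ ω, (s * Y ω) ^ 2 * Real.exp (t * (s * Y ω)) ∂μ) / s ^ 2) = 0 := by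
  have e : ∀ ω, steinQuad T a₀ a₁ a₂ (fun y => Real.exp (s * t * y)) (Y ω) =
      (∑ l ∈ Finset.range (T + 1), a₀ l * (s * t) ^ l) * (Y ω ^ 0 * Real.exp (s * t * Y ω)) +
      (∑ l ∈ Finset.range (T + 1), a₁ l * (s * t) ^ l) * (Y ω ^ 1 * Real.exp (s * t * Y ω)) +
      (∑ l ∈ Finset.range (T + 1), a₂ l * (s * t) ^ l) * (Y ω ^ 2 * Real.exp (s * t * Y ω)) := by
    intro ω
    unfold steinQuad
    rw [Finset.sum_mul, Finset.sum_mul, Finset.sum_mul, ← Finset.sum_add_distrib,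
      ← Finset.sum_add_distrib]
    refine Finset.sum_congr rfl fun l _ => ?_
    rw [iteratedDeriv_exp_const_mul]
    ring
  have h := fun n => int_Yexp μ Y s hs h1 ht n
  simp only [e] at H
  rw [integral_add (by exact ((h 0).1.const_mul _).add ((h 1).1.const_mul _)) ((h 2).1.const_mul _),
    integral_add ((h 0).1.const_mul _) ((h 1).1.const_mul _), integral_const_mul, integral_const_mul,
    integral_const_mul, (h 0).2, (h 1).2, (h 2).2] at H
  simpa [mgf] using H

lemma wr_arith (p0 p1 p2 s M M1 M2 N N1 N2 : ℝ) (hs : s ≠ 0) (hp : p2 ≠ 0)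
    (h : p0 * M + p1 * (M1 / s) + p2 * (M2 / s ^ 2) = 0)
    (h' : p0 * N + p1 * (N1 / s) + p2 * (N2 / s ^ 2) = 0) :
    M * N2 - M2 * N = -(s * (p1 / p2)) * (M * N1 - M1 * N) := by
  field_simp at h h' ⊢
  linear_combination M * h' - N * h

lemma exp_of_stein {Ω : Type*} [MeasurableSpace Ω] (μ : Measure Ω) [IsProbabilityMeasure μ]
    (Y : Ω → ℝ) (hY : Measurable Y) (hYmom : Integrable (fun ω => (Y ω) ^ 2) μ)
    (T k : ℕ) (a₀ a₁ a₂ : ℕ → ℝ) (hk : k + 2 ≤ T) (h2 : ∀ l < k + 2, a₂ l = 0)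
    (h22 : a₂ (k + 2) ≠ 0) (h1 : ∀ l < k, a₁ l = 0) (h11 : a₁ k ≠ 0)
    (H : ∀ f, BB f → ∫ ω, steinQuad T a₀ a₁ a₂ f (Y ω) ∂μ = 0) :
    ∃ s₀ > 0, ∀ s, 0 < s * (a₁ k / a₂ (k + 2)) → |s| ≤ s₀ →
      Integrable (fun ω => Real.exp (s * Y ω)) μ := by
  have h0 := a0_zero μ Y hY hYmom T a₀ a₁ a₂ k hk h2 h1 H
  have H2 := ann_all μ Y hY hYmom (T - k) (fun l => a₀ (l + k)) (fun l => a₁ (l + k))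
    (fun l => a₂ (l + k)) k (fun f hf => by
      have := H f hf
      simp only [stein_eq_Sq] at this
      simpa only [Sq_shift T k (by omega) a₀ a₁ a₂ h0 h1 (fun l hl => h2 l (by omega))] using this)
  have := exp_moment μ Y hY hYmom (T - k) (by omega) _ _ _ (by simpa using h2 k (by omega))
    (by simpa [add_comm] using h2 (k + 1) (by omega)) (by simpa [add_comm] using h22)
    (by simpa using h11) H2
  simpa [add_comm] using this

/-- Theorem, case (ii): a Stein operator with quadratic coefficients
characterises its target distribution, provided `p(t) ∼ a i / t² + b / t` as `t → 0`,
with `a ∈ ℝ \ {0}` and `b ≥ -2`; i.e. `lim_{t→0} t² p(t) = a i` and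
`lim_{t→0} t (p(t) − a i / t²) = b`. -/
theorem stein_quadratic_coefficients_characterise_even_pole
    {Ω Ω' : Type*} [MeasurableSpace Ω] [MeasurableSpace Ω']
    (μ : Measure Ω) [IsProbabilityMeasure μ] (ν : Measure Ω') [IsProbabilityMeasure ν]
    (T : ℕ) (a₀ a₁ a₂ : ℕ → ℝ)
    (Y : Ω → ℝ) (hY : Measurable Y)
    (hYcont : Measure.map Y μ ≪ volume)
    (hYmom : Integrable (fun ω => (Y ω) ^ 2) μ)
    (hSY : ∀ f : ℝ → ℝ, memFquad μ Y T f → ∫ ω, steinQuad T a₀ a₁ a₂ f (Y ω) ∂μ = 0)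
    (a b : ℝ) (ha : a ≠ 0) (hb : -2 ≤ b)
    (hlim1 : Tendsto (fun t : ℝ => (t : ℂ) ^ 2 * pFun T a₁ a₂ t)
      (𝓝[≠] (0 : ℝ)) (𝓝 ((a : ℂ) * Complex.I)))
    (hlim2 : Tendsto (fun t : ℝ => (t : ℂ) *
        (pFun T a₁ a₂ t - (a : ℂ) * Complex.I / (t : ℂ) ^ 2))
      (𝓝[≠] (0 : ℝ)) (𝓝 (b : ℂ)))
    (W : Ω' → ℝ) (hW : Measurable W)
    (hWmom : Integrable (fun ω => (W ω) ^ 2) ν)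
    (hSW : ∀ f : ℝ → ℝ, memFquad μ Y T f → ∫ ω, steinQuad T a₀ a₁ a₂ f (W ω) ∂ν = 0) :
    Measure.map W ν = Measure.map Y μ := by
  obtain ⟨k, hk, h2, h22, h1, h11⟩ := coeffs T a₁ a₂ a ha hlim1
  obtain ⟨s1, hs1, E1⟩ := exp_of_stein μ Y hY hYmom T k a₀ a₁ a₂ hk h2 h22 h1 h11
    (fun f hf => hSY f (BB_mem μ Y hY hYmom hf T))
  obtain ⟨s2, hs2, E2⟩ := exp_of_stein ν W hW hWmom T k a₀ a₁ a₂ hk h2 h22 h1 h11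
    (fun f hf => hSW f (BB_mem μ Y hY hYmom hf T))
  have hκ : a₁ k / a₂ (k + 2) ≠ 0 := div_ne_zero h11 h22
  obtain ⟨s, hs, hsl⟩ : ∃ s, 0 < s * (a₁ k / a₂ (k + 2)) ∧ |s| ≤ min s1 s2 := by
    have hm : 0 < min s1 s2 := lt_min hs1 hs2
    rcases lt_or_gt_of_ne hκ with h | h
    · exact ⟨-(min s1 s2), by nlinarith, by rw [abs_neg, abs_of_pos hm]⟩
    · exact ⟨min s1 s2, by positivity, by rw [abs_of_pos hm]⟩
  have hs0 : s ≠ 0 := by rintro rfl; simp at hs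
  have iY := E1 s hs (hsl.trans (min_le_left _ _))
  have iW := E2 s hs (hsl.trans (min_le_right _ _))
  obtain ⟨δ, hδ, hδ1, hδr⟩ := poly_ratio T k a₁ a₂ hk h2 h1 h22 s hs
  have hX : Measurable (fun ω => s * Y ω) := by fun_prop
  have hZ : Measurable (fun ω => s * W ω) := by fun_prop
  have hX2 : Integrable (fun ω => (s * Y ω) ^ 2) μ := by
    simpa only [mul_pow] using hYmom.const_mul (s ^ 2)
  have hZ2 : Integrable (fun ω => (s * W ω) ^ 2) ν := by
    simpa only [mul_pow] using hWmom.const_mul (s ^ 2)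
  obtain ⟨C1, hC1, B1⟩ := mgf_bd μ _ hX hX2 iY
  obtain ⟨C2, hC2, B2⟩ := mgf_bd ν _ hZ hZ2 iW
  have hsub : ∀ t ∈ Ioo 0 δ, t ∈ Ioo (0:ℝ) 1 := fun t ht => ⟨ht.1, by linarith [ht.2]⟩
  have key : ∀ t ∈ Ioo 0 δ, mgf (fun ω => s * Y ω) μ t = mgf (fun ω => s * W ω) ν t := by
    refine ode_unique (mgf (fun ω => s * Y ω) μ)
      (fun t => ∫ ω, (s * Y ω) * Real.exp (t * (s * Y ω)) ∂μ)
      (fun t => ∫ ω, (s * Y ω) ^ 2 * Real.exp (t * (s * Y ω)) ∂μ)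
      (mgf (fun ω => s * W ω) ν)
      (fun t => ∫ ω, (s * W ω) * Real.exp (t * (s * W ω)) ∂ν)
      (fun t => ∫ ω, (s * W ω) ^ 2 * Real.exp (t * (s * W ω)) ∂ν)
      (fun τ => s * ((∑ l ∈ Finset.range (T + 1), a₁ l * (s * τ) ^ l) /
          (∑ l ∈ Finset.range (T + 1), a₂ l * (s * τ) ^ l)))
      δ (s * (a₁ k / a₂ (k + 2)) / (2 * s ^ 2)) (C1 * C2 + C1 * C2) hδ (by positivity)
      (fun t ht => hasDerivAt_mgf (mem_int μ _ iY (hsub t ht))) ?_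
      (fun t ht => hasDerivAt_mgf (mem_int ν _ iW (hsub t ht))) ?_ ?_
      (fun t ht => (hδr t ht.1 ht.2).2) ?_ ?_
      (mgf_lim_real μ _ hX iY) (mgf_lim_real ν _ hZ iW)
    · intro t ht
      have := hasDerivAt_integral_pow_mul_exp_real (mem_int μ _ iY (hsub t ht)) 1
      simpa using this
    · intro t ht
      have := hasDerivAt_integral_pow_mul_exp_real (mem_int ν _ iW (hsub t ht)) 1
      simpa using this
    · intro t ht
      have hm := mem_exp μ Y s hs0 iY (hsub t ht) T
      exact wr_arith _ _ _ s _ _ _ _ _ _ hs0 (hδr t ht.1 ht.2).1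
        (stein_exp μ Y s hs0 iY (hsub t ht) T a₀ a₁ a₂ (hSY _ hm))
        (stein_exp ν W s hs0 iW (hsub t ht) T a₀ a₁ a₂ (hSW _ hm))
    · intro t ht
      obtain ⟨b1, b2⟩ := B1 t ht.1.le (by linarith [ht.2])
      obtain ⟨b3, b4⟩ := B2 t ht.1.le (by linarith [ht.2])
      refine (abs_sub _ _).trans (add_le_add ?_ ?_)
      · rw [abs_mul]; exact mul_le_mul b1 b4 (abs_nonneg _) hC1
      · rw [abs_mul]; exact mul_le_mul b2 b3 (abs_nonneg _) hC1
    · intro t ht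
      exact mgf_pos (show t ∈ integrableExpSet (fun ω => s * Y ω) μ from
        interior_subset (mem_int μ _ iY (hsub t ht)))
  have hlaw := law_eq μ ν _ hX iY _ hZ iW δ hδ hδ1 key
  have hmap := congrArg (Measure.map (fun x => s⁻¹ * x)) hlaw
  rw [Measure.map_map (by fun_prop) hX, Measure.map_map (by fun_prop) hZ] at hmap
  have eY : ((fun x => s⁻¹ * x) ∘ fun ω => s * Y ω) = Y := by
    funext ω; simp [hs0]
  have eW : ((fun x => s⁻¹ * x) ∘ fun ω => s * W ω) = W := by
    funext ω; simp [hs0]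
  rw [eY, eW] at hmap
  exact hmap.symm
end

section
/- Let X be a standard Gaussian random variable (density (2π)^{−1/2}e^{−x²/2} on ℝ) and let Y be a semicircular random variable with density (2/π)√(1−x²) on [−1,1]. Define the operator S f(x) = (1−x²)f^{(5)}(x) + (x³−4x)f^{(4)}(x) + (5−2x²)f^{(3)}(x) + (3x³−21x)f''(x) + 9x² f'(x) − 9x f(x). Then for every function f ∈ C⁵(ℝ) satisfying E[|X^j f^{(t)}(X)|] < ∞ and E[|Y^j f^{(t)}(Y)|] < ∞ for all t = 0, …, 5 and j = 0, …, 3, one has both E[S f(X)] = 0 and E[S f(Y)] = 0; that is, S is a Stein operator simultaneously for the standard Gaussian and the semicircular distribution. -/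
open MeasureTheory ProbabilityTheory Filter Set
open scoped Topology

/-- The standard Gaussian distribution, with density `(2π)^(-1/2) exp(-x²/2)` on `ℝ`. -/
noncomputable def stdGaussian : Measure ℝ :=
  volume.withDensity fun x =>
    ENNReal.ofReal ((Real.sqrt (2 * Real.pi))⁻¹ * Real.exp (-x ^ 2 / 2))

/-- The semicircular distribution, with density `(2/π) √(1 - x²)` on `[-1, 1]`. -/
noncomputable def semicircle : Measure ℝ :=
  volume.withDensity fun x =>
    ENNReal.ofReal (Set.indicator (Set.Icc (-1 : ℝ) 1)
      (fun x => (2 / Real.pi) * Real.sqrt (1 - x ^ 2)) x)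

/-- The operator
`S f x = (1-x²) f⁽⁵⁾ + (x³-4x) f⁽⁴⁾ + (5-2x²) f⁽³⁾ + (3x³-21x) f'' + 9x² f' - 9x f`. -/
noncomputable def steinGS (f : ℝ → ℝ) (x : ℝ) : ℝ :=
  (1 - x ^ 2) * iteratedDeriv 5 f x + (x ^ 3 - 4 * x) * iteratedDeriv 4 f x
    + (5 - 2 * x ^ 2) * iteratedDeriv 3 f x + (3 * x ^ 3 - 21 * x) * iteratedDeriv 2 f x
    + 9 * x ^ 2 * deriv f x - 9 * x * f x

theorem hd_iter (f : ℝ → ℝ) (hf : ContDiff ℝ 5 f) (t : ℕ) (ht : t < 5) (x : ℝ) :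
    HasDerivAt (iteratedDeriv t f) (iteratedDeriv (t + 1) f x) x := by
  rw [iteratedDeriv_succ]
  exact ((hf.differentiable_iteratedDeriv t (by exact_mod_cast ht)) x).hasDerivAt

theorem cont_iter (f : ℝ → ℝ) (hf : ContDiff ℝ 5 f) (t : ℕ) (ht : t ≤ 5) :
    Continuous (iteratedDeriv t f) :=
  hf.continuous_iteratedDeriv t (by exact_mod_cast ht)

theorem gauss_integrable (g : ℝ → ℝ) (h : Integrable g stdGaussian) :
    Integrable (fun x => Real.exp (-x ^ 2 / 2) * g x) := by
  have hc : (Real.sqrt (2 * Real.pi))⁻¹ ≠ 0 := by positivity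
  unfold _root_.stdGaussian at h
  rw [integrable_withDensity_iff_integrable_smul' (by fun_prop)
    (Eventually.of_forall fun _ => ENNReal.ofReal_lt_top)] at h
  have h2 := h.const_mul (Real.sqrt (2 * Real.pi))
  refine h2.congr (Eventually.of_forall fun x => ?_)
  simp only [smul_eq_mul]
  rw [ENNReal.toReal_ofReal (by positivity)]
  field_simp

theorem gauss_integral (g : ℝ → ℝ) :
    ∫ x, g x ∂stdGaussian =
      (Real.sqrt (2 * Real.pi))⁻¹ * ∫ x, Real.exp (-x ^ 2 / 2) * g x := by
  unfold _root_.stdGaussian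
  rw [integral_withDensity_eq_integral_toReal_smul (by fun_prop)
    (Eventually.of_forall fun _ => ENNReal.ofReal_lt_top),
    ← integral_const_mul]
  congr 1
  ext x
  rw [ENNReal.toReal_ofReal (by positivity), smul_eq_mul, mul_assoc]

theorem semi_integral (g : ℝ → ℝ) :
    ∫ x, g x ∂semicircle =
      (2 / Real.pi) * ∫ x in (-1 : ℝ)..1, Real.sqrt (1 - x ^ 2) * g x := by
  unfold semicircle
  have hm : Measurable (Set.indicator (Set.Icc (-1 : ℝ) 1)
      (fun x => (2 / Real.pi) * Real.sqrt (1 - x ^ 2))) :=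
    Measurable.indicator (by fun_prop) measurableSet_Icc
  rw [integral_withDensity_eq_integral_toReal_smul hm.ennreal_ofReal (by simp),
    intervalIntegral.integral_of_le (by norm_num), ← integral_Icc_eq_integral_Ioc,
    ← integral_const_mul, ← integral_indicator measurableSet_Icc]
  congr 1
  ext x
  by_cases hx : x ∈ Set.Icc (-1 : ℝ) 1
  · rw [Set.indicator_of_mem hx, Set.indicator_of_mem hx,
      ENNReal.toReal_ofReal (by positivity), smul_eq_mul, mul_assoc]
  · rw [Set.indicator_of_notMem hx, Set.indicator_of_notMem hx]
    simp

/-- `steinGS` is a Stein operator simultaneously for the standard Gaussian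
and the semicircular distribution: for every `f ∈ C⁵(ℝ)` with
`E|X^j f^(t)(X)| < ∞` and `E|Y^j f^(t)(Y)| < ∞` for `t = 0,…,5`, `j = 0,…,3`,
one has `E[S f(X)] = 0` and `E[S f(Y)] = 0`. -/
theorem steinGS_annihilates_gaussian_and_semicircle
    (f : ℝ → ℝ) (hf : ContDiff ℝ 5 f)
    (hX : ∀ t ≤ 5, ∀ j ≤ 3,
      Integrable (fun x => x ^ j * iteratedDeriv t f x) stdGaussian)
    (hY : ∀ t ≤ 5, ∀ j ≤ 3,
      Integrable (fun x => x ^ j * iteratedDeriv t f x) semicircle) :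
    (∫ x, steinGS f x ∂stdGaussian) = 0 ∧ (∫ x, steinGS f x ∂semicircle) = 0 := by
  have d0 : ∀ x, HasDerivAt f (deriv f x) x := fun x => by
    simpa using hd_iter f hf 0 (by norm_num) x
  have d1 : ∀ x, HasDerivAt (deriv f) (iteratedDeriv 2 f x) x := fun x => by
    simpa using hd_iter f hf 1 (by norm_num) x
  have d2 := hd_iter f hf 2 (by norm_num)
  have d3 := hd_iter f hf 3 (by norm_num)
  have d4 := hd_iter f hf 4 (by norm_num)
  norm_num at d2 d3 d4
  have c0 : Continuous f := hf.continuous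
  have c1 : Continuous (deriv f) := by simpa using cont_iter f hf 1 (by norm_num)
  have c2 := cont_iter f hf 2 (by norm_num)
  have c3 := cont_iter f hf 3 (by norm_num)
  have c4 := cont_iter f hf 4 (by norm_num)
  have c5 := cont_iter f hf 5 (by norm_num)
  constructor
  · rw [gauss_integral]
    have hI : ∀ t ≤ 5, ∀ j ≤ 3, Integrable
        (fun x => Real.exp (-x ^ 2 / 2) * (x ^ j * iteratedDeriv t f x)) := fun t ht j hj =>
      gauss_integrable _ (hX t ht j hj)
    have e0 : iteratedDeriv 0 f = f := iteratedDeriv_zero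
    have e1 : iteratedDeriv 1 f = deriv f := iteratedDeriv_one
    have i5 := fun j hj => hI 5 (by norm_num) j hj
    have i4 := fun j hj => hI 4 (by norm_num) j hj
    have i3 := fun j hj => hI 3 (by norm_num) j hj
    have i2 := fun j hj => hI 2 (by norm_num) j hj
    have i1 := fun j hj => hI 1 (by norm_num) j hj
    have i0 := fun j hj => hI 0 (by norm_num) j hj
    rw [e1] at i1
    rw [e0] at i0
    have key := integral_eq_zero_of_hasDerivAt_of_integrable
      (f := fun x => Real.exp (-x ^ 2 / 2) * ((1 - x ^ 2) * iteratedDeriv 4 f x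
        + (-x) * iteratedDeriv 3 f x + (6 - 3 * x ^ 2) * iteratedDeriv 2 f x
        + (-9 * x) * deriv f x + 9 * f x))
      (f' := fun x => Real.exp (-x ^ 2 / 2) * steinGS f x) ?_ ?_ ?_
    · rw [key, mul_zero]
    · intro x
      have hw : HasDerivAt (fun x : ℝ => Real.exp (-x ^ 2 / 2))
          (Real.exp (-x ^ 2 / 2) * (-x)) x := by
        have h : HasDerivAt (fun x : ℝ => -x ^ 2 / 2) (-x) x := by
          have := (hasDerivAt_pow 2 x).neg.div_const 2
          refine this.congr_deriv ?_
          norm_num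
          ring
        exact h.exp
      have hx := hasDerivAt_id' x
      have hx2 : HasDerivAt (fun x : ℝ => x ^ 2) (2 * x) x := by
        simpa using hasDerivAt_pow 2 x
      have H := hw.mul ((((((hx2.const_sub 1).mul (d4 x)).add (hx.neg.mul (d3 x))).add
        (((hx2.const_mul 3).const_sub 6).mul (d2 x))).add
        ((hx.const_mul (-9)).mul (d1 x))).add ((d0 x).const_mul 9))
      refine H.congr_deriv ?_
      simp only [steinGS, Pi.add_apply, Pi.mul_apply, Pi.neg_apply]
      ring
    · have := ((((((i5 0 (by norm_num)).sub (i5 2 (by norm_num))).add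
        ((i4 3 (by norm_num)).sub ((i4 1 (by norm_num)).const_mul 4))).add
        (((i3 0 (by norm_num)).const_mul 5).sub ((i3 2 (by norm_num)).const_mul 2))).add
        (((i2 3 (by norm_num)).const_mul 3).sub ((i2 1 (by norm_num)).const_mul 21))).add
        ((i1 2 (by norm_num)).const_mul 9)).sub ((i0 1 (by norm_num)).const_mul 9)
      refine this.congr (Eventually.of_forall fun x => ?_)
      simp only [steinGS, Pi.add_apply, Pi.sub_apply]
      ring
    · have := (((((i4 0 (by norm_num)).sub (i4 2 (by norm_num))).sub
        (i3 1 (by norm_num))).add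
        (((i2 0 (by norm_num)).const_mul 6).sub ((i2 2 (by norm_num)).const_mul 3))).sub
        ((i1 1 (by norm_num)).const_mul 9)).add ((i0 0 (by norm_num)).const_mul 9)
      refine this.congr (Eventually.of_forall fun x => ?_)
      simp only [Pi.add_apply, Pi.sub_apply]
      ring
  · rw [semi_integral]
    have cS : Continuous (steinGS f) := by
      unfold steinGS
      fun_prop
    have key := intervalIntegral.integral_eq_sub_of_hasDerivAt_of_le (a := -1) (b := 1)
      (by norm_num)
      (f := fun x => Real.sqrt (1 - x ^ 2) * ((1 - x ^ 2) * (iteratedDeriv 4 f x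
        + (-x) * iteratedDeriv 3 f x + 6 * iteratedDeriv 2 f x
        + (-3 * x) * deriv f x + 3 * f x)))
      (f' := fun x => Real.sqrt (1 - x ^ 2) * steinGS f x) ?_ ?_ ?_
    · rw [key]
      norm_num
    · fun_prop
    · intro x hx
      have hpos : 0 < 1 - x ^ 2 := by nlinarith [hx.1, hx.2]
      have hx' := hasDerivAt_id' x
      have hx2 : HasDerivAt (fun x : ℝ => x ^ 2) (2 * x) x := by
        simpa using hasDerivAt_pow 2 x
      have hw := (hx2.const_sub 1).sqrt hpos.ne'
      have H := hw.mul ((hx2.const_sub 1).mul (((((d4 x)).add (hx'.neg.mul (d3 x))).add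
        ((d2 x).const_mul 6)).add
        ((hx'.const_mul (-3)).mul (d1 x)) |>.add ((d0 x).const_mul 3)))
      refine H.congr_deriv ?_
      have hs : 0 < Real.sqrt (1 - x ^ 2) := Real.sqrt_pos.mpr hpos
      have hsq : Real.sqrt (1 - x ^ 2) ^ 2 = 1 - x ^ 2 := Real.sq_sqrt hpos.le
      have hdiv : -(2 * x) / (2 * Real.sqrt (1 - x ^ 2)) * (1 - x ^ 2)
          = -x * Real.sqrt (1 - x ^ 2) := by
        rw [← hsq, Real.sqrt_sq hs.le]
        field_simp
      simp only [steinGS, Pi.add_apply, Pi.mul_apply, Pi.neg_apply]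
      rw [← mul_assoc, hdiv]
      ring
    · exact (by fun_prop : Continuous fun x => Real.sqrt (1 - x ^ 2) * steinGS f x).intervalIntegrable _ _
end
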